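/- arXiv:1610.01401 — 2 statements merged into one kernel-verified Lean document; each statement's English description precedes it below -/
import Mathlib

section
/- Let d ≥ 1 be an integer and let (g_k)_{k≥1} be non-negative integers with g_k = 0 whenever d does not divide k, such that g(z) = Σ_{k≥1} g_k z^k belongs to the class S_d with radius of convergence ρ ∈ (0,1). Then the infinite product Π_{k≥1} (1−ρ^k)^{−g_k} converges to a finite value, and the coefficients of the Euler product P(z) = Π_{k≥1} (1−z^k)^{−g_k} satisfy [z^n] P(z) ~ (Π_{k≥1} (1−ρ^k)^{−g_k})·[z^n] g(z) as n → ∞ along multiples of d. -/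
/-- A power series with coefficient sequence `g`, non-negative coefficients and radius of
convergence `ρ ∈ (0,∞)`, belongs to the class `𝒮_d`. -/
def SubexpClass (d : ℕ) (g : ℕ → ℝ) (ρ : ℝ) : Prop :=
  1 ≤ d ∧ 0 < ρ ∧ (∀ n, 0 ≤ g n) ∧
  (∀ n, ¬ d ∣ n → g n = 0) ∧
  (∃ N, ∀ n, N ≤ n → d ∣ n → 0 < g n) ∧
  Summable (fun n => g n * ρ ^ n) ∧
  (∀ r : ℝ, ρ < r → ¬ Summable (fun n => g n * r ^ n)) ∧
  Filter.Tendsto (fun m => g (d * m) / g (d * m + d)) Filter.atTop (nhds (ρ ^ d)) ∧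
  Filter.Tendsto
    (fun m => (∑ i ∈ Finset.range (d * m + 1), g i * g (d * m - i)) / g (d * m))
    Filter.atTop (nhds (2 * ∑' n, g n * ρ ^ n))


open Finset

noncomputable def ebFib (g : ℕ → ℕ) (n : ℕ) : Finset ((Σ k : ℕ, Fin (g k)) →₀ ℕ) := by
  classical
  exact (Finset.finsupp ((range (n+1)).sigma fun _ => univ) (fun _ => range (n+1))).filter
    (fun f => (f.sum fun t c => c * t.1) = n)

lemma eb_le (g : ℕ → ℕ) (f : (Σ k : ℕ, Fin (g k)) →₀ ℕ) (t : Σ k : ℕ, Fin (g k)) :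
    f t * t.1 ≤ f.sum fun t c => c * t.1 := by
  by_cases h : t ∈ f.support
  · exact Finset.single_le_sum (f := fun t => f t * t.1) (fun _ _ => Nat.zero_le _) h
  · simp [Finsupp.notMem_support_iff.1 h]

lemma eb_pos (g : ℕ → ℕ) (hg0 : g 0 = 0) (t : Σ k : ℕ, Fin (g k)) : 1 ≤ t.1 := by
  rcases t with ⟨k, i⟩
  rcases Nat.eq_zero_or_pos k with h | h
  · subst h; rw [hg0] at i; exact i.elim0
  · exact h

lemma mem_ebFib (g : ℕ → ℕ) (hg0 : g 0 = 0) (n : ℕ) (f : (Σ k : ℕ, Fin (g k)) →₀ ℕ) :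
    f ∈ ebFib g n ↔ (f.sum fun t c => c * t.1) = n := by
  classical
  unfold ebFib
  rw [Finset.mem_filter, Finset.mem_finsupp_iff]
  constructor
  · exact fun h => h.2
  · intro h
    refine ⟨⟨?_, ?_⟩, h⟩
    · intro t ht
      simp only [mem_sigma, mem_range, mem_univ, and_true]
      have h1 := eb_le g f t
      have h2 : 1 ≤ f t := Nat.one_le_iff_ne_zero.2 (Finsupp.mem_support_iff.1 ht)
      nlinarith
    · intro t _
      have h1 := eb_le g f t
      have h2 := eb_pos g hg0 t
      simp only [mem_range]
      nlinarith

lemma eb_card (g : ℕ → ℕ) (hg0 : g 0 = 0) (n : ℕ) :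
    Nat.card {f : (Σ k : ℕ, Fin (g k)) →₀ ℕ // (f.sum fun t c => c * t.1) = n}
      = (ebFib g n).card := by
  classical
  have : ({f : (Σ k : ℕ, Fin (g k)) →₀ ℕ | (f.sum fun t c => c * t.1) = n}) = ↑(ebFib g n) := by
    ext f; simp [mem_ebFib g hg0]
  change Nat.card ↥({f : (Σ k : ℕ, Fin (g k)) →₀ ℕ | (f.sum fun t c => c * t.1) = n}) = _
  rw [this]; simp

lemma eb_sum_add (g : ℕ → ℕ) (f : (Σ k : ℕ, Fin (g k)) →₀ ℕ) (t : Σ k : ℕ, Fin (g k)) (j : ℕ) :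
    ((f + Finsupp.single t j).sum fun t c => c * t.1) = (f.sum fun t c => c * t.1) + j * t.1 := by
  classical
  rw [Finsupp.sum_add_index' (by simp) (by intros; ring)]
  simp

lemma eb_shift (g : ℕ → ℕ) (hg0 : g 0 = 0) (n j : ℕ) (t : Σ k : ℕ, Fin (g k)) :
    ((ebFib g n).filter (fun f => j ≤ f t)).card
      = if j * t.1 ≤ n then (ebFib g (n - j * t.1)).card else 0 := by
  classical
  split_ifs with h
  · symm
    refine Finset.card_bij (fun f _ => f + Finsupp.single t j) ?_ ?_ ?_
    · intro f hf
      rw [mem_ebFib g hg0] at hf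
      rw [Finset.mem_filter, mem_ebFib g hg0, eb_sum_add, hf]
      refine ⟨by omega, by simp⟩
    · intro a _ b _ hab
      exact add_right_cancel hab
    · intro f hf
      rw [Finset.mem_filter, mem_ebFib g hg0] at hf
      have he : f - Finsupp.single t j + Finsupp.single t j = f := by
        apply tsub_add_cancel_of_le
        simpa using hf.2
      refine ⟨f - Finsupp.single t j, ?_, he⟩
      rw [mem_ebFib g hg0]
      have := eb_sum_add g (f - Finsupp.single t j) t j
      rw [he, hf.1] at this
      omega
  · rw [Finset.card_eq_zero, Finset.filter_eq_empty_iff]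
    intro f hf hj
    rw [mem_ebFib g hg0] at hf
    have := eb_le g f t
    have : j * t.1 ≤ f t * t.1 := Nat.mul_le_mul_right _ hj
    omega

def ebC (g : ℕ → ℕ) (k : ℕ) : ℕ := ∑ s ∈ k.divisors, s * g s

lemma eb_rec (g : ℕ → ℕ) (hg0 : g 0 = 0) (n : ℕ) :
    n * (ebFib g n).card = ∑ k ∈ range (n+1), ebC g k * (ebFib g (n - k)).card := by
  classical
  have h1 : n * (ebFib g n).card =
      ∑ f ∈ ebFib g n, ∑ t ∈ (range (n+1)).sigma (fun k => (univ : Finset (Fin (g k)))), f t * t.1 := by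
    rw [mul_comm, ← smul_eq_mul, ← Finset.sum_const]
    refine Finset.sum_congr rfl fun f hf => ?_
    have hf' := (mem_ebFib g hg0 n f).1 hf
    conv_lhs => rw [← hf']
    refine Finset.sum_subset ?_ ?_
    · unfold ebFib at hf
      rw [Finset.mem_filter, Finset.mem_finsupp_iff] at hf
      exact hf.1.1
    · intro t _ ht
      simp [Finsupp.notMem_support_iff.1 ht]
  have h2 : ∀ t : Σ k : ℕ, Fin (g k), ∑ f ∈ ebFib g n, f t * t.1 =
      ∑ j ∈ Icc 1 n, t.1 * (if j * t.1 ≤ n then (ebFib g (n - j * t.1)).card else 0) := by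
    intro t
    have : ∀ f ∈ ebFib g n, f t * t.1 = ∑ j ∈ Icc 1 n, t.1 * (if j ≤ f t then 1 else 0) := by
      intro f hf
      have hf' := (mem_ebFib g hg0 n f).1 hf
      have h1 := eb_le g f t
      have h2 := eb_pos g hg0 t
      have h3 : f t ≤ n := by nlinarith
      rw [← Finset.mul_sum, mul_comm, ← Finset.card_filter]
      congr 1
      have : (Icc 1 n).filter (fun j => j ≤ f t) = Icc 1 (f t) := by
        ext j; simp; omega
      rw [this]; simp
    rw [Finset.sum_congr rfl this, Finset.sum_comm]
    refine Finset.sum_congr rfl fun j _ => ?_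
    rw [← Finset.mul_sum, ← Finset.card_filter, eb_shift g hg0]
  rw [h1, Finset.sum_comm, Finset.sum_congr rfl (fun t _ => h2 t), Finset.sum_sigma]
  simp only [Finset.sum_const, card_univ, Fintype.card_fin, smul_eq_mul]
  have h3 : ∀ s j : ℕ, (if j * s ≤ n then (ebFib g (n - j * s)).card else 0)
      = ∑ k ∈ range (n+1), if j * s = k then (ebFib g (n - k)).card else 0 := by
    intro s j
    rw [Finset.sum_ite_eq]
    simp
  simp only [h3, Finset.mul_sum]
  have h4 : ∀ s ∈ range (n+1), (∑ i ∈ Icc 1 n, ∑ k ∈ range (n+1), g s * (s * if i * s = k then (ebFib g (n - k)).card else 0))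
     = ∑ k ∈ range (n+1), ∑ i ∈ Icc 1 n, g s * (s * if i * s = k then (ebFib g (n - k)).card else 0) :=
    fun s _ => Finset.sum_comm
  rw [Finset.sum_congr rfl h4, Finset.sum_comm]
  refine Finset.sum_congr rfl fun k hk => ?_
  have hk' : k ≤ n := by simpa [Nat.lt_succ_iff] using hk
  unfold ebC
  rw [Finset.sum_mul]
  symm
  rw [← Finset.sum_subset (s₁ := k.divisors) (s₂ := range (n+1))]
  · refine Finset.sum_congr rfl fun s hs => ?_
    obtain ⟨⟨i, hi⟩, hk0⟩ := Nat.mem_divisors.1 hs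
    have hs0 : 0 < s := Nat.pos_of_mem_divisors hs
    rw [Finset.sum_eq_single i]
    · rw [if_pos (by rw [hi, mul_comm])]; ring
    · intro j _ hj
      rw [if_neg]; · simp
      intro h
      apply hj
      rw [hi, mul_comm] at h
      exact Nat.eq_of_mul_eq_mul_left hs0 h
    · intro h
      exfalso; apply h
      rw [Finset.mem_Icc]
      constructor
      · rcases Nat.eq_zero_or_pos i with h | h
        · subst h; omega
        · exact h
      · nlinarith
  · intro s hs
    have := Nat.divisor_le hs
    simp; omega
  · intro s _ hs
    refine Finset.sum_eq_zero fun i hi => ?_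
    by_cases h : i * s = k
    · rw [Nat.mem_divisors] at hs
      have : k = 0 := by
        by_contra h0
        exact hs ⟨⟨i, by rw [← h, mul_comm]⟩, h0⟩
      have : s = 0 := by
        rw [this] at h
        rw [Finset.mem_Icc] at hi
        rcases Nat.mul_eq_zero.1 h with h | h <;> omega
      simp [this]
    · simp [h]

open Filter Topology in
lemma eb_prod (g : ℕ → ℕ) (hg0 : g 0 = 0) (ρ : ℝ) (h0 : 0 < ρ) (h1 : ρ < 1)
    (hs : Summable fun n => ((ebFib g n).card : ℝ) * ρ ^ n) :
    HasProd (fun k : ℕ => ((1 - ρ ^ (k + 1))⁻¹) ^ (g (k + 1)))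
      (∑' n, ((ebFib g n).card : ℝ) * ρ ^ n) := by
  classical
  set w : ((Σ k : ℕ, Fin (g k)) →₀ ℕ) → ℕ := fun f => f.sum fun t c => c * t.1 with hw
  set F : ((Σ k : ℕ, Fin (g k)) →₀ ℕ) → ℝ := fun f => ρ ^ w f with hF
  have hF0 : ∀ f, 0 ≤ F f := fun f => by positivity
  have hfin : ∀ n, Finite {f // w f = n} := by
    intro n
    have : ({f | w f = n}) = ↑(ebFib g n) := by
      ext f; simp [mem_ebFib g hg0, hw]
    change Finite ↥({f | w f = n})
    rw [this]; exact Finset.finite_toSet _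
  have hfib : ∀ n, HasSum (fun f : {f // w f = n} => F f.1) (((ebFib g n).card : ℝ) * ρ ^ n) := by
    intro n
    have := hfin n
    have : Fintype {f // w f = n} := Fintype.ofFinite _
    have hc : (fun f : {f // w f = n} => F f.1) = fun _ => ρ ^ n := by
      funext f; simp only [hF, f.2]
    rw [hc]
    have := hasSum_fintype (fun _ : {f // w f = n} => ρ ^ n)
    rw [Finset.sum_const, nsmul_eq_mul, Finset.card_univ, ← Nat.card_eq_fintype_card,
      eb_card g hg0] at this
    exact this
  have hsumσ : Summable (fun x : Σ n, {f // w f = n} => F x.2.1) := by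
    rw [summable_sigma_of_nonneg (fun x => hF0 _)]
    refine ⟨fun n => (hfib n).summable, ?_⟩
    simpa only [(hfib _).tsum_eq] using hs
  have hQσ : HasSum (fun x : Σ n, {f // w f = n} => F x.2.1)
      (∑' n, ((ebFib g n).card : ℝ) * ρ ^ n) := by
    have := hsumσ.hasSum
    rwa [(this.sigma hfib).tsum_eq.symm] at this
  have hQ : HasSum F (∑' n, ((ebFib g n).card : ℝ) * ρ ^ n) :=
    (Equiv.hasSum_iff (Equiv.sigmaFiberEquiv w)).1 hQσ
  have hFs := hQ.summable
  have hsub : ∀ (P : ((Σ k : ℕ, Fin (g k)) →₀ ℕ) → Prop) [DecidablePred P], Summable (fun f => if P f then F f else 0) := by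
    intro P _
    refine Summable.of_nonneg_of_le (fun f => ?_) (fun f => ?_) hFs
    · split_ifs; exacts [hF0 f, le_rfl]
    · split_ifs; exacts [le_rfl, hF0 f]
  have hpr : ∀ s : Finset (Σ k : ℕ, Fin (g k)),
      ∑' f, (if f.support ⊆ s then F f else 0) = ∏ t ∈ s, (1 - ρ ^ t.1)⁻¹ := by
    intro s
    induction s using Finset.induction_on with
    | empty =>
      rw [tsum_eq_single 0]
      · simp [hF, hw]
      · intro f hf
        rw [if_neg]
        simpa using hf
    | insert t s hts ih =>
      rw [Finset.prod_insert hts, ← ih]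
      set S := ∑' f, (if f.support ⊆ insert t s then F f else 0) with hS
      have ht := eb_pos g hg0 t
      have hlt : ρ ^ t.1 < 1 := pow_lt_one₀ h0.le h1 (by omega)
      have hkey : S = ∑' f, (if f.support ⊆ s then F f else 0) + ρ ^ t.1 * S := by
        have e1 : ∀ f : (Σ k : ℕ, Fin (g k)) →₀ ℕ, (if f.support ⊆ insert t s then F f else 0) =
          (if f.support ⊆ s then F f else 0) +
            (if f.support ⊆ insert t s ∧ f t ≠ 0 then F f else 0) := by
          intro f
          have : f.support ⊆ s ↔ f.support ⊆ insert t s ∧ f t = 0 := by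
            constructor
            · intro h
              refine ⟨h.trans (Finset.subset_insert _ _), ?_⟩
              by_contra h0
              exact hts (h (Finsupp.mem_support_iff.2 h0))
            · rintro ⟨h, h0⟩ x hx
              rcases Finset.mem_insert.1 (h hx) with rfl | h
              · exact absurd h0 (Finsupp.mem_support_iff.1 hx)
              · exact h
          rw [if_congr this rfl rfl]
          by_cases hA : f.support ⊆ insert t s <;> by_cases hB : f t = 0 <;> simp [hA, hB]
        have e2 : ∑' f : (Σ k : ℕ, Fin (g k)) →₀ ℕ,
            (if f.support ⊆ insert t s ∧ f t ≠ 0 then F f else 0) = ρ ^ t.1 * S := by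
          rw [hS, ← tsum_mul_left]
          have hinj : Function.Injective
            (fun f : (Σ k : ℕ, Fin (g k)) →₀ ℕ => f + Finsupp.single t 1) :=
              fun a b hab => add_right_cancel hab
          rw [← hinj.tsum_eq]
          · refine tsum_congr fun f => ?_
            have hsp : (f + Finsupp.single t 1).support ⊆ insert t s ∧ (f + Finsupp.single t 1 : (Σ k : ℕ, Fin (g k)) →₀ ℕ) t ≠ 0
               ↔ f.support ⊆ insert t s := by
              constructor
              · rintro ⟨h, _⟩ x hx
                apply h
                simp only [Finsupp.mem_support_iff, Finsupp.add_apply] at hx ⊢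
                omega
              · intro h
                refine ⟨?_, by simp⟩
                intro x hx
                by_cases hxt : x = t
                · simp [hxt]
                · apply h
                  simp only [Finsupp.mem_support_iff, Finsupp.add_apply] at hx ⊢
                  rwa [Finsupp.single_eq_of_ne hxt, add_zero] at hx
            rw [if_congr hsp rfl rfl]
            split_ifs
            · simp only [hF, hw, eb_sum_add, pow_add, one_mul]; ring
            · simp
          · intro f hf
            have hf' : f t ≠ 0 := by
              by_contra h
              simp [h] at hf
            refine ⟨f - Finsupp.single t 1, ?_⟩
            apply tsub_add_cancel_of_le
            simp only [Finsupp.single_le_iff]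
            omega
        rw [← e2, hS, ← Summable.tsum_add (hsub _) (hsub _)]
        exact tsum_congr e1
      have : (1 - ρ ^ t.1) ≠ 0 := by linarith
      field_simp
      linarith
  have hT : HasProd (fun t : Σ k : ℕ, Fin (g k) => (1 - ρ ^ t.1)⁻¹)
      (∑' n, ((ebFib g n).card : ℝ) * ρ ^ n) := by
    rw [HasProd, SummationFilter.unconditional_filter, ← hQ.tsum_eq]
    simp only [← hpr]
    refine tendsto_tsum_of_dominated_convergence (bound := F) hFs ?_ ?_
    · intro f
      refine tendsto_const_nhds.congr' ?_
      filter_upwards [eventually_ge_atTop f.support] with s hs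
      rw [if_pos hs]
    · refine Eventually.of_forall fun s f => ?_
      split_ifs
      · rw [Real.norm_of_nonneg (hF0 f)]
      · simpa using hF0 f
  have hK := hT.sigma (g := fun k => ((1 - ρ ^ k)⁻¹) ^ g k) (by
    intro k
    have := hasProd_fintype (fun c : Fin (g k) => (1 - ρ ^ k)⁻¹)
    simpa using this)
  have hinj : Function.Injective (fun k : ℕ => k + 1) := fun a b h => by simpa using h
  refine (hinj.hasProd_iff (f := fun k => ((1 - ρ ^ k)⁻¹) ^ g k) ?_).2 hK
  intro x hx
  have : x = 0 := by
    by_contra h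
    exact hx ⟨x - 1, by simp; omega⟩
  simp [this, hg0]

lemma eb_split (F : ℕ → ℝ) (n K : ℕ) (h : 2 * K ≤ n + 1) :
    ∑ k ∈ range (n+1), F k = ∑ k ∈ range K, F k + ∑ k ∈ Ico K (n+1-K), F k
      + ∑ j ∈ range K, F (n - j) := by
  have h3 : ∑ j ∈ range K, F (n - j) = ∑ k ∈ Ico (n+1-K) (n+1), F k := by
    rw [Finset.range_eq_Ico, Finset.sum_Ico_reflect F 0 (by omega)]
    simp
  rw [h3, Finset.range_eq_Ico, Finset.range_eq_Ico, Finset.sum_Ico_consecutive _ (by omega) (by omega),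
    Finset.sum_Ico_consecutive _ (by omega) (by omega)]

open Filter Topology in
lemma eb_analytic (b e q : ℕ → ℝ) (hb : ∀ n, 0 ≤ b n) (he : ∀ n, 0 ≤ e n) (hq : ∀ n, 0 ≤ q n)
    (N : ℕ) (hbN : ∀ n, N ≤ n → 0 < b n) (hbs : Summable b)
    (hratio : Tendsto (fun m => b m / b (m+1)) atTop (𝓝 1))
    (hconv : Tendsto (fun n => (∑ i ∈ range (n+1), b i * b (n-i)) / b n) atTop (𝓝 (2 * ∑' n, b n)))
    (heb : Tendsto (fun n => e n / b n) atTop (𝓝 1))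
    (hrec : ∀ n : ℕ, (n:ℝ) * q n = ∑ k ∈ range (n+1), (k:ℝ) * e k * q (n-k)) :
    Summable q ∧ Tendsto (fun n => q n / b n) atTop (𝓝 (∑' n, q n)) := by
  have hshift : ∀ j, Tendsto (fun n => b (n - j) / b n) atTop (𝓝 1) := by
    intro j
    rw [← tendsto_add_atTop_iff_nat j]
    simp only [Nat.add_sub_cancel]
    induction j with
    | zero =>
      refine tendsto_const_nhds.congr' ?_
      filter_upwards [eventually_ge_atTop N] with n hn
      simp [(hbN n hn).ne']
    | succ j ih =>
      have h2 : Tendsto (fun n => b (n+j) / b (n+j+1)) atTop (𝓝 1) :=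
        (tendsto_add_atTop_iff_nat (f := fun m => b m / b (m+1)) j).2 hratio
      have := ih.mul h2
      rw [one_mul] at this
      refine this.congr' ?_
      filter_upwards [eventually_ge_atTop N] with n hn
      have := (hbN (n+j) (by omega)).ne'
      rw [← add_assoc]
      field_simp
  have heshift : ∀ j, Tendsto (fun n => e (n - j) / b n) atTop (𝓝 1) := by
    intro j
    have h1 : Tendsto (fun n => e (n-j) / b (n-j)) atTop (𝓝 1) :=
      heb.comp (tendsto_sub_atTop_nat j)
    have := h1.mul (hshift j)
    rw [one_mul] at this
    refine this.congr' ?_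
    filter_upwards [eventually_ge_atTop (N+j)] with n hn
    have := (hbN (n-j) (by omega)).ne'
    field_simp
  have hmid : ∀ K, Tendsto (fun n => (∑ k ∈ Ico K (n+1-K), b k * b (n-k)) / b n) atTop
      (𝓝 (2 * (∑' n, b n - ∑ k ∈ range K, b k))) := by
    intro K
    have h1 : Tendsto (fun n => ∑ k ∈ range K, b k * (b (n-k) / b n)) atTop
        (𝓝 (∑ k ∈ range K, b k * 1)) :=
      tendsto_finsetSum _ fun k _ => (hshift k).const_mul _
    have h2 := hconv.sub (h1.const_mul 2)
    simp only [mul_one] at h2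
    rw [← mul_sub] at h2
    refine h2.congr' ?_
    filter_upwards [eventually_ge_atTop (N + 2 * K)] with n hn
    have hbn := (hbN n (by omega)).ne'
    rw [eb_split _ n K (by omega)]
    have : ∑ j ∈ range K, b (n-j) * b (n-(n-j)) = ∑ k ∈ range K, b k * b (n-k) := by
      refine Finset.sum_congr rfl fun j hj => ?_
      have : n - (n - j) = j := by have := Finset.mem_range.1 hj; omega
      rw [this, mul_comm]
    rw [this]
    have h4 : ∑ k ∈ range K, b k * (b (n-k) / b n) = (∑ k ∈ range K, b k * b (n-k)) / b n := by
      rw [Finset.sum_div]; exact Finset.sum_congr rfl fun k _ => by rw [mul_div_assoc]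
    rw [h4]
    field_simp
    ring
  have htail : Tendsto (fun K => 2 * (∑' n, b n - ∑ k ∈ range K, b k)) atTop (𝓝 0) := by
    have := (hbs.hasSum.tendsto_sum_nat.const_sub (∑' n, b n)).const_mul 2
    simpa using this
  obtain ⟨N1, hN1⟩ : ∃ N1, ∀ n, N1 ≤ n → N ≤ n ∧ e n ≤ 2 * b n := by
    have h1 := heb.eventually_le_const (show (1:ℝ) < 2 by norm_num)
    obtain ⟨N1, h⟩ := eventually_atTop.1 (h1.and (eventually_ge_atTop N))
    refine ⟨N1, fun n hn => ⟨(h n hn).2, ?_⟩⟩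
    have := (h n hn).1
    rwa [div_le_iff₀ (hbN n (h n hn).2)] at this
  -- first part
  have hfirst : ∀ K, Tendsto (fun n : ℕ => (∑ k ∈ range K, (k:ℝ) * e k * b (n-k)) / (n * b n))
      atTop (𝓝 0) := by
    intro K
    have h1 : Tendsto (fun n => ∑ k ∈ range K, (k:ℝ) * e k * (b (n-k) / b n)) atTop
        (𝓝 (∑ k ∈ range K, (k:ℝ) * e k * 1)) :=
      tendsto_finsetSum _ fun k _ => (hshift k).const_mul _
    have h2 := h1.mul (tendsto_one_div_atTop_nhds_zero_nat (𝕜 := ℝ))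
    rw [mul_zero] at h2
    refine h2.congr fun n => ?_
    rw [Finset.sum_mul, Finset.sum_div]
    refine Finset.sum_congr rfl fun k _ => ?_
    rw [mul_div_assoc, mul_assoc ((k:ℝ) * e k)]
    congr 1
    rw [div_mul_div_comm, mul_one, mul_comm (b n)]
  -- last part
  have hlast : ∀ K, Tendsto (fun n : ℕ => (∑ j ∈ range K, ((n-j : ℕ):ℝ) * e (n-j) * q j) / (n * b n))
      atTop (𝓝 (∑ j ∈ range K, q j)) := by
    intro K
    have hn : ∀ j : ℕ, Tendsto (fun n : ℕ => ((n-j : ℕ):ℝ) / n) atTop (𝓝 1) := by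
      intro j
      have h1 := ((tendsto_one_div_atTop_nhds_zero_nat (𝕜 := ℝ)).const_mul (j:ℝ)).const_sub 1
      rw [mul_zero, sub_zero] at h1
      refine h1.congr' ?_
      filter_upwards [eventually_ge_atTop (j+1)] with n hn
      rw [Nat.cast_sub (by omega)]
      have : (n:ℝ) ≠ 0 := by
        have : n ≠ 0 := by omega
        exact_mod_cast this
      field_simp
    have h1 : Tendsto (fun n => ∑ j ∈ range K, (((n-j : ℕ):ℝ) / n * (e (n-j) / b n)) * q j) atTop
        (𝓝 (∑ j ∈ range K, (1 * 1) * q j)) :=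
      tendsto_finsetSum _ fun k _ => ((hn k).mul (heshift k)).mul_const _
    simp only [one_mul] at h1
    refine h1.congr fun n => ?_
    rw [Finset.sum_div]
    refine Finset.sum_congr rfl fun k _ => ?_
    rw [div_mul_div_comm, div_mul_eq_mul_div]
  -- the split of the recursion
  have hsplit : ∀ n K : ℕ, 2 * K ≤ n → (n:ℝ) * q n = ∑ k ∈ range K, (k:ℝ) * e k * q (n-k)
      + ∑ k ∈ Ico K (n+1-K), (k:ℝ) * e k * q (n-k)
      + ∑ j ∈ range K, ((n-j : ℕ):ℝ) * e (n-j) * q j := by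
    intro n K h
    rw [hrec, eb_split _ n K (by omega)]
    congr 1
    refine Finset.sum_congr rfl fun j hj => ?_
    have : n - (n - j) = j := by have := Finset.mem_range.1 hj; omega
    rw [this]
  -- bounds given a bound on the ratio
  have hbd1 : ∀ (K n : ℕ) (M : ℝ), 2 * K ≤ n → (∀ m, K ≤ m → m < n → q m ≤ M * b m) →
      ∑ k ∈ range K, (k:ℝ) * e k * q (n-k) ≤ M * ∑ k ∈ range K, (k:ℝ) * e k * b (n-k) := by
    intro K n M hn h
    rw [Finset.mul_sum]
    refine Finset.sum_le_sum fun k hk => ?_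
    have hk := Finset.mem_range.1 hk
    rcases Nat.eq_zero_or_pos k with h0 | h0
    · simp [h0]
    · have := h (n-k) (by omega) (by omega)
      have h2 : 0 ≤ (k:ℝ) * e k := mul_nonneg (by positivity) (he k)
      nlinarith
  have hbd2 : ∀ (K n : ℕ) (M : ℝ), N1 ≤ K → 1 ≤ K → (∀ m, K ≤ m → m < n → q m ≤ M * b m) →
      0 ≤ M →
      ∑ k ∈ Ico K (n+1-K), (k:ℝ) * e k * q (n-k) ≤
        n * (2 * M * ∑ k ∈ Ico K (n+1-K), b k * b (n-k)) := by
    intro K n M hK hK1 h hM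
    rw [Finset.mul_sum, Finset.mul_sum]
    refine Finset.sum_le_sum fun k hk => ?_
    have hk := Finset.mem_Ico.1 hk
    have h1 := h (n-k) (by omega) (by omega)
    have h2 := (hN1 k (by omega)).2
    have h3 : (k:ℝ) ≤ n := by exact_mod_cast (by omega : k ≤ n)
    have h4 := hb (n-k)
    calc (k:ℝ) * e k * q (n-k) ≤ n * (2 * b k) * (M * b (n-k)) := by
          have := he k; have := hq (n-k); have := hb k
          gcongr
      _ = _ := by ring
  -- boundedness
  obtain ⟨K0, hK0⟩ : ∃ K0, ∀ K, K0 ≤ K → N1 ≤ K ∧ 1 ≤ K ∧ 2 * (∑' n, b n - ∑ k ∈ range K, b k) < 1/8 := by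
    obtain ⟨K0, h⟩ := eventually_atTop.1 ((eventually_ge_atTop N1).and ((eventually_ge_atTop 1).and
      (htail.eventually_lt_const (show (0:ℝ) < 1/8 by norm_num))))
    exact ⟨K0, h⟩
  obtain ⟨hKN1, hK1, hKt⟩ := hK0 K0 le_rfl
  have hbound : ∃ M, 0 ≤ M ∧ ∀ n, K0 ≤ n → q n ≤ M * b n := by
    set D := ∑ j ∈ range K0, q j + 1 with hD
    have hD0 : 0 ≤ D := by
      have : 0 ≤ ∑ j ∈ range K0, q j := Finset.sum_nonneg fun j _ => hq j
      linarith
    obtain ⟨n0, hn0⟩ := eventually_atTop.1 (((hfirst K0).eventually_le_const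
      (show (0:ℝ) < 1/4 by norm_num)).and (((hmid K0).eventually_le_const hKt).and
        (((hlast K0).eventually_le_const (show _ < D by rw [hD]; linarith)).and
          ((eventually_ge_atTop (2*K0))))))
    have hstep : ∀ n, n0 ≤ n → ∀ M, 0 ≤ M → (∀ m, K0 ≤ m → m < n → q m ≤ M * b m) →
        q n ≤ (M / 2 + D) * b n := by
      intro n hn M hM h
      obtain ⟨h1, h2, h3, h4⟩ := hn0 n hn
      have hbn : 0 < b n := hbN n ((hN1 n (by omega)).1)
      have hn' : (0:ℝ) < n := by exact_mod_cast (by omega : 0 < n)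
      rw [div_le_iff₀ (by positivity)] at h1 h3
      rw [div_le_iff₀ hbn] at h2
      have hs := hsplit n K0 h4
      have g1 := (hbd1 K0 n M h4 h).trans (mul_le_mul_of_nonneg_left h1 hM)
      have g2 := (hbd2 K0 n M hKN1 hK1 h hM).trans
        (mul_le_mul_of_nonneg_left (mul_le_mul_of_nonneg_left h2 (by positivity : 0 ≤ 2 * M)) hn'.le)
      have : (n:ℝ) * q n ≤ n * ((M / 2 + D) * b n) := by
        rw [hs]
        linarith
      exact le_of_mul_le_mul_left this hn'
    set M := 2 * D + ∑ m ∈ range n0, q m / b m with hM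
    have hnn : ∀ m, 0 ≤ q m / b m := fun m => div_nonneg (hq m) (hb m)
    have hsum0 : 0 ≤ ∑ m ∈ range n0, q m / b m := Finset.sum_nonneg fun m _ => hnn m
    have hM0 : 0 ≤ M := by linarith
    refine ⟨M, hM0, ?_⟩
    intro n
    induction n using Nat.strong_induction_on with
    | _ n ih =>
      intro hn
      have hbn : 0 < b n := hbN n ((hN1 n (by omega)).1)
      rcases lt_or_ge n n0 with h | h
      · rw [← div_le_iff₀ hbn]
        have := Finset.single_le_sum (f := fun m => q m / b m) (fun m _ => hnn m)
          (Finset.mem_range.2 h)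
        linarith
      · have := hstep n h M hM0 (fun m hm hmn => ih m hmn hm)
        refine this.trans ?_
        apply mul_le_mul_of_nonneg_right _ hbn.le
        linarith
  obtain ⟨M, hM0, hM⟩ := hbound
  have hqs : Summable q := by
    rw [← summable_nat_add_iff K0]
    refine Summable.of_nonneg_of_le (fun n => hq _) (fun n => hM (n+K0) (by omega)) ?_
    exact ((summable_nat_add_iff K0).2 hbs).mul_left M
  refine ⟨hqs, ?_⟩
  rw [Metric.tendsto_atTop]
  intro ε hε
  have hδ : 0 < ε / (8 * (M + 1)) := by positivity
  obtain ⟨K, hK, hKt, hKq⟩ := ((eventually_ge_atTop K0).and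
    ((htail.eventually_lt_const hδ).and
      (Metric.tendsto_nhds.1 hqs.hasSum.tendsto_sum_nat (ε/4) (by positivity)))).exists
  have hlast' := Metric.tendsto_nhds.1 (hlast K) (ε/4) (by positivity)
  obtain ⟨n0, hn0⟩ := eventually_atTop.1 (((hfirst K).eventually_lt_const hδ).and
    (((hmid K).eventually_lt_const hKt).and (hlast'.and (eventually_ge_atTop (2*K)))))
  refine ⟨n0, fun n hn => ?_⟩
  obtain ⟨h1, h2, h3, h4⟩ := hn0 n hn
  obtain ⟨hKN, hK1', -⟩ := hK0 K hK
  have hbn : 0 < b n := hbN n ((hN1 n (by omega)).1)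
  have hn' : (0:ℝ) < n := by exact_mod_cast (by omega : 0 < n)
  have hs := hsplit n K h4
  have hMK : ∀ m, K ≤ m → m < n → q m ≤ M * b m := fun m hm _ => hM m (by omega)
  have g1 := hbd1 K n M h4 hMK
  have g2 := hbd2 K n M hKN hK1' hMK hM0
  set A := ∑ k ∈ range K, (k:ℝ) * e k * q (n-k) with hA
  set B := ∑ k ∈ Ico K (n+1-K), (k:ℝ) * e k * q (n-k) with hB
  set C := ∑ j ∈ range K, ((n-j : ℕ):ℝ) * e (n-j) * q j with hC
  have hA0 : 0 ≤ A := Finset.sum_nonneg fun k _ =>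
    mul_nonneg (mul_nonneg (by positivity) (he _)) (hq _)
  have hB0 : 0 ≤ B := Finset.sum_nonneg fun k _ =>
    mul_nonneg (mul_nonneg (by positivity) (he _)) (hq _)
  have hnb : 0 < (n:ℝ) * b n := by positivity
  have hdec : q n / b n = A / (n * b n) + B / (n * b n) + C / (n * b n) := by
    rw [← add_div, ← add_div, ← hs]
    field_simp
  have hMε : M * (ε / (8 * (M+1))) ≤ ε / 8 := by
    rw [mul_div_assoc', div_le_div_iff₀ (by positivity) (by positivity)]
    nlinarith
  have a1 : A / (n * b n) ≤ ε / 8 := by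
    refine le_trans ?_ hMε
    refine le_trans ?_ (mul_le_mul_of_nonneg_left h1.le hM0)
    rw [mul_div_assoc']
    gcongr
  have a2 : B / (n * b n) ≤ 2 * (ε / 8) := by
    refine le_trans ?_ (mul_le_mul_of_nonneg_left hMε (by norm_num : (0:ℝ) ≤ 2))
    refine le_trans ?_ (mul_le_mul_of_nonneg_left (mul_le_mul_of_nonneg_left h2.le hM0) (by norm_num : (0:ℝ) ≤ 2))
    rw [div_le_iff₀ hnb]
    refine g2.trans (le_of_eq ?_)
    field_simp
  have a1' : 0 ≤ A / (n * b n) := by positivity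
  have a2' : 0 ≤ B / (n * b n) := by positivity
  rw [Real.dist_eq, abs_lt] at h3 hKq ⊢
  rw [hdec]
  constructor <;> linarith [h3.1, h3.2, hKq.1, hKq.2]

lemma eb_mult (F : ℕ → ℝ) (d m : ℕ) (hd : 1 ≤ d) (hF : ∀ n, ¬ d ∣ n → F n = 0) :
    ∑ i ∈ range (d * m + 1), F i = ∑ j ∈ range (m + 1), F (d * j) := by
  classical
  have hinj : Function.Injective (fun j : ℕ => d * j) := fun a b h =>
    Nat.eq_of_mul_eq_mul_left hd h
  rw [← Finset.sum_image (f := F) (g := fun j => d * j) (s := range (m+1)) (fun a _ b _ h => hinj h)]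
  symm
  refine Finset.sum_subset ?_ ?_
  · intro i hi
    obtain ⟨j, hj, rfl⟩ := Finset.mem_image.1 hi
    have hj := Finset.mem_range.1 hj
    have : d * j ≤ d * m := Nat.mul_le_mul_left _ (by omega)
    simp; omega
  · intro i hi hni
    apply hF
    rintro ⟨j, rfl⟩
    apply hni
    refine Finset.mem_image.2 ⟨j, ?_, rfl⟩
    have hi := Finset.mem_range.1 hi
    have : d * j ≤ d * m := by omega
    have := Nat.le_of_mul_le_mul_left this hd
    simp; omega

lemma ebC_zero (g : ℕ → ℕ) (d : ℕ) (hg : ∀ n, ¬ d ∣ n → g n = 0) (n : ℕ) (hn : ¬ d ∣ n) :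
    ebC g n = 0 := by
  unfold ebC
  refine Finset.sum_eq_zero fun s hs => ?_
  rw [hg s, mul_zero]
  intro h
  exact hn (h.trans (Nat.dvd_of_mem_divisors hs))

lemma ebFib_zero (g : ℕ → ℕ) (hg0 : g 0 = 0) (d : ℕ) (hg : ∀ n, ¬ d ∣ n → g n = 0) (n : ℕ)
    (hn : ¬ d ∣ n) : (ebFib g n).card = 0 := by
  rw [Finset.card_eq_zero, Finset.eq_empty_iff_forall_notMem]
  intro f hf
  rw [mem_ebFib g hg0] at hf
  apply hn
  rw [← hf]
  refine Finset.dvd_sum fun t _ => ?_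
  by_contra h
  have h2 : ¬ d ∣ t.1 := fun h3 => h (h3.mul_left _)
  have := hg _ h2
  rcases t with ⟨k, i⟩
  simp only at this
  rw [this] at i
  exact i.elim0

lemma ebC_le (g : ℕ → ℕ) (ρ B : ℝ) (h0 : 0 < ρ) (h1 : ρ < 1) (hB : ∀ n, (g n : ℝ) * ρ ^ n ≤ B)
    (n : ℕ) (hn : 1 ≤ n) :
    (ebC g n : ℝ) * ρ ^ n ≤ n * (g n * ρ ^ n) + n * (B * (n * (√ρ) ^ n)) := by
  have hB0 : 0 ≤ B := le_trans (by positivity) (hB 0)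
  have hr0 : 0 ≤ √ρ := Real.sqrt_nonneg _
  have hr1 : √ρ ≤ 1 := by rw [Real.sqrt_le_left (by norm_num)]; simpa using h1.le
  have hr2 : (√ρ) ^ 2 = ρ := Real.sq_sqrt h0.le
  unfold ebC
  rw [← Nat.cons_self_properDivisors (by omega), Finset.sum_cons]
  push_cast
  rw [add_mul, Finset.sum_mul, mul_assoc]
  gcongr
  calc ∑ s ∈ n.properDivisors, (s:ℝ) * (g s) * ρ ^ n
      ≤ ∑ s ∈ n.properDivisors, (n:ℝ) * (B * (√ρ) ^ n) := by
        refine Finset.sum_le_sum fun s hs => ?_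
        obtain ⟨⟨c, hc⟩, hlt⟩ := Nat.mem_properDivisors.1 hs
        have h2s : 2 * s ≤ n := by
          have : 2 ≤ c := by
            by_contra h
            have : c = 0 ∨ c = 1 := by omega
            rcases this with rfl | rfl <;> omega
          nlinarith
        have e1 : ρ ^ n = ρ ^ s * ρ ^ (n - s) := by rw [← pow_add]; congr 1; omega
        have e2 : ρ ^ (n - s) ≤ (√ρ) ^ n := by
          conv_lhs => rw [← hr2]
          rw [← pow_mul]
          exact pow_le_pow_of_le_one hr0 hr1 (by omega)
        have e3 : (s:ℝ) ≤ n := by exact_mod_cast hlt.le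
        calc (s:ℝ) * (g s) * ρ ^ n = s * ((g s * ρ ^ s) * ρ ^ (n-s)) := by rw [e1]; ring
          _ ≤ n * (B * (√ρ) ^ n) := by
            have := hB s
            gcongr
    _ = (n.properDivisors.card : ℝ) * (n * (B * (√ρ) ^ n)) := by
        rw [Finset.sum_const, nsmul_eq_mul]
    _ ≤ (n:ℝ) * (n * (B * (√ρ) ^ n)) := by
        gcongr
        have : n.properDivisors ⊆ range n := fun s hs => by
          have := (Nat.mem_properDivisors.1 hs).2
          simpa using this
        simpa using Finset.card_le_card this
    _ = _ := by ring

open Filter Topology in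
lemma eb_small (b : ℕ → ℝ) (N : ℕ) (hbN : ∀ n, N ≤ n → 0 < b n)
    (hratio : Tendsto (fun m => b m / b (m+1)) atTop (𝓝 1)) (x : ℝ) (h0 : 0 < x) (h1 : x < 1) :
    Tendsto (fun m : ℕ => (m:ℝ) * x ^ m / b m) atTop (𝓝 0) := by
  apply Summable.tendsto_atTop_zero
  refine summable_of_ratio_test_tendsto_lt_one h1 ?_ ?_
  · filter_upwards [eventually_ge_atTop (N+1)] with n hn
    have h2 := hbN n (by omega)
    have : (0:ℝ) < n := by exact_mod_cast (by omega : 0 < n)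
    positivity
  · have h2 : Tendsto (fun n : ℕ => 1 + 1 / (n:ℝ)) atTop (𝓝 (1 + 0)) :=
      (tendsto_one_div_atTop_nhds_zero_nat (𝕜 := ℝ)).const_add 1
    have h3 := (h2.mul hratio).mul_const x
    simp only [add_zero, one_mul] at h3
    refine h3.congr' ?_
    filter_upwards [eventually_ge_atTop (N+1)] with n hn
    have h2 := hbN n (by omega)
    have h2' := hbN (n+1) (by omega)
    have : (0:ℝ) < n := by exact_mod_cast (by omega : 0 < n)
    rw [Real.norm_of_nonneg (by positivity), Real.norm_of_nonneg (by positivity)]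
    push_cast
    field_simp
    try ring

/-- Let `(g_k)_{k ≥ 1}` be non-negative integers, supported on multiples of `d`, whose
generating series belongs to `𝒮_d` with radius of convergence `ρ ∈ (0,1)`. Then the Euler
product `∏_{k ≥ 1} (1 - ρ^k)^{-g_k}` converges to a finite value, and the coefficients of
`P(z) = ∏_{k ≥ 1} (1 - z^k)^{-g_k}` — which count multisets of total size `n` built from
`g_k` distinct objects of each size `k` — satisfy
`[z^n] P(z) ∼ (∏_{k ≥ 1} (1 - ρ^k)^{-g_k}) · [z^n] g(z)` along multiples of `d`. -/
theorem euler_product_coeff_asymptotics (d : ℕ) (g : ℕ → ℕ) (ρ : ℝ)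
    (hg0 : g 0 = 0) (hρ1 : ρ < 1)
    (hsub : SubexpClass d (fun k => (g k : ℝ)) ρ) :
    Multipliable (fun k : ℕ => ((1 - ρ ^ (k + 1))⁻¹) ^ (g (k + 1))) ∧
    Filter.Tendsto
      (fun m =>
        (Nat.card {f : (Σ k : ℕ, Fin (g k)) →₀ ℕ // (f.sum fun t c => c * t.1) = d * m} : ℝ)
          / (g (d * m) : ℝ))
      Filter.atTop
      (nhds (∏' k : ℕ, ((1 - ρ ^ (k + 1))⁻¹) ^ (g (k + 1)))) := by

  classical
  obtain ⟨hd, hρ0, -, hgd', ⟨N, hN⟩, hsum, -, hrat, hcv⟩ := hsub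
  have hgd : ∀ n, ¬ d ∣ n → g n = 0 := fun n hn => by simpa using hgd' n hn
  have hinj : Function.Injective (fun j : ℕ => d * j) := fun a b h =>
    Nat.eq_of_mul_eq_mul_left hd h
  have hdR : (0:ℝ) < d := by exact_mod_cast hd
  have hle : ∀ m, m ≤ d * m := fun m => Nat.le_mul_of_pos_left m hd
  have hnr : ∀ n, n ∉ Set.range (fun j : ℕ => d * j) → ¬ d ∣ n := by
    rintro n hn ⟨j, rfl⟩
    exact hn ⟨j, rfl⟩
  set b : ℕ → ℝ := fun m => (g (d*m) : ℝ) * ρ ^ (d*m) with hb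
  set q : ℕ → ℝ := fun m => ((ebFib g (d*m)).card : ℝ) * ρ ^ (d*m) with hq
  set e : ℕ → ℝ := fun m => (ebC g (d*m) : ℝ) * ρ ^ (d*m) / ((d*m : ℕ) : ℝ) with he
  have hbN : ∀ n, N ≤ n → 0 < b n := fun n hn =>
    mul_pos (hN (d*n) (hn.trans (hle n)) (dvd_mul_right _ _)) (by positivity)
  have hsupp : ∀ x, x ∉ Set.range (fun j : ℕ => d * j) → (g x : ℝ) * ρ ^ x = 0 := by
    intro n hn
    rw [hgd n (hnr n hn)]; simp
  have hbs : Summable b := (hinj.summable_iff hsupp).2 hsum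
  have hbt : ∑' n, b n = ∑' n, (g n : ℝ) * ρ ^ n := by
    refine hinj.tsum_eq (f := fun n => (g n : ℝ) * ρ ^ n) ?_
    intro n hn
    by_contra h
    exact hn (hsupp n h)
  have hratio : Filter.Tendsto (fun m => b m / b (m+1)) Filter.atTop (nhds 1) := by
    have h1 := hrat.div_const (ρ ^ d)
    rw [div_self (by positivity)] at h1
    refine h1.congr fun m => ?_
    simp only [hb, mul_add, mul_one, pow_add]
    field_simp
  have hconv : Filter.Tendsto (fun n => (∑ i ∈ range (n+1), b i * b (n-i)) / b n) Filter.atTop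
      (nhds (2 * ∑' n, b n)) := by
    rw [hbt]
    refine hcv.congr fun m => ?_
    rw [eb_mult (fun i => (g i : ℝ) * g (d*m-i)) d m hd
      (fun n hn => by simp [hgd n hn])]
    have : ∑ i ∈ range (m+1), b i * b (m-i) =
        (∑ j ∈ range (m+1), (g (d*j) : ℝ) * g (d*m-d*j)) * ρ ^ (d*m) := by
      rw [Finset.sum_mul]
      refine Finset.sum_congr rfl fun j hj => ?_
      have hj := Finset.mem_range.1 hj
      have hjm : d * j ≤ d * m := Nat.mul_le_mul_left _ (by omega)
      have e1 : ρ ^ (d*m) = ρ ^ (d*j) * ρ ^ (d*m-d*j) := by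
        rw [← pow_add]; congr 1; omega
      simp only [hb]
      rw [Nat.mul_sub, e1]; ring
    rw [this]
    simp only [hb]
    rw [mul_div_mul_right _ _ (by positivity)]
  have hB : ∀ n, (g n : ℝ) * ρ ^ n ≤ ∑' n, (g n : ℝ) * ρ ^ n := fun n =>
    hsum.le_tsum n (fun j _ => by positivity)
  have heb : Filter.Tendsto (fun n => e n / b n) Filter.atTop (nhds 1) := by
    set B := ∑' n, (g n : ℝ) * ρ ^ n
    have hr0 : 0 < √ρ := Real.sqrt_pos.2 hρ0
    have hr1 : √ρ < 1 := by rw [Real.sqrt_lt' one_pos]; simpa using hρ1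
    have hsm := eb_small b N hbN hratio ((√ρ)^d) (by positivity) (pow_lt_one₀ hr0.le hr1 (by omega))
    have hup := (hsm.const_mul (B * d)).const_add 1
    rw [mul_zero, add_zero] at hup
    refine tendsto_of_tendsto_of_tendsto_of_le_of_le' tendsto_const_nhds hup ?_ ?_
    · filter_upwards [Filter.eventually_ge_atTop (N+1)] with m hm
      have hbm := hbN m (by omega)
      have hm' : (0:ℝ) < (d * m : ℕ) := by exact_mod_cast (by have := hle m; omega : 0 < d * m)
      rw [le_div_iff₀ hbm, one_mul]
      simp only [he, hb]
      rw [le_div_iff₀ hm']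
      have : (d*m) * g (d*m) ≤ ebC g (d*m) := by
        unfold ebC
        exact Finset.single_le_sum (f := fun s => s * g s) (fun _ _ => Nat.zero_le _)
          (Nat.mem_divisors_self _ (by have := hle m; omega))
      have : ((d*m : ℕ) : ℝ) * g (d*m) ≤ ebC g (d*m) := by exact_mod_cast this
      have hp : 0 ≤ ρ ^ (d*m) := by positivity
      nlinarith
    · filter_upwards [Filter.eventually_ge_atTop (N+1)] with m hm
      have hbm := hbN m (by omega)
      have hm' : (0:ℝ) < (d * m : ℕ) := by exact_mod_cast (by have := hle m; omega : 0 < d * m)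
      have h1 := ebC_le g ρ B hρ0 hρ1 hB (d*m) (by have := hle m; omega)
      rw [div_le_iff₀ hbm]
      simp only [he]
      rw [div_le_iff₀ hm']
      refine h1.trans (le_of_eq ?_)
      change _ * b m + _ = _
      rw [pow_mul]
      push_cast
      field_simp
  have hrec : ∀ n : ℕ, (n:ℝ) * q n = ∑ k ∈ range (n+1), (k:ℝ) * e k * q (n-k) := by
    intro m
    have h1 : (((d*m : ℕ) : ℝ)) * ((ebFib g (d*m)).card : ℝ)
        = ∑ k ∈ range (d*m+1), (ebC g k : ℝ) * ((ebFib g (d*m - k)).card : ℝ) := by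
      exact_mod_cast eb_rec g hg0 (d*m)
    rw [eb_mult _ d m hd (fun n hn => by simp [ebC_zero g d hgd n hn])] at h1
    have h2 : ∀ k ∈ range (m+1), (k:ℝ) * e k * q (m-k) =
        (ebC g (d*k) : ℝ) * ((ebFib g (d*m - d*k)).card : ℝ) * (ρ ^ (d*m) / d) := by
      intro k hk
      have hk := Finset.mem_range.1 hk
      have hjm : d * k ≤ d * m := Nat.mul_le_mul_left _ (by omega)
      have e1 : ρ ^ (d*m) = ρ ^ (d*k) * ρ ^ (d*m-d*k) := by
        rw [← pow_add]; congr 1; omega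
      simp only [he, hq]
      rw [Nat.mul_sub, e1]
      rcases Nat.eq_zero_or_pos k with h0 | h0
      · subst h0; simp [ebC]
      · have : (0:ℝ) < k := by exact_mod_cast h0
        push_cast
        field_simp
    rw [Finset.sum_congr rfl h2, ← Finset.sum_mul, ← h1]
    simp only [hq]
    push_cast
    field_simp
  obtain ⟨hqs, hqt⟩ := eb_analytic b e q (fun n => by positivity) (fun n => by positivity)
    (fun n => by positivity) N hbN hbs hratio hconv heb hrec
  have hsupp2 : ∀ x, x ∉ Set.range (fun j : ℕ => d * j) → ((ebFib g x).card : ℝ) * ρ ^ x = 0 := by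
    intro n hn
    rw [ebFib_zero g hg0 d hgd n (hnr n hn)]; simp
  have hps : Summable fun n => ((ebFib g n).card : ℝ) * ρ ^ n := (hinj.summable_iff hsupp2).1 hqs
  have hpt : ∑' n, q n = ∑' n, ((ebFib g n).card : ℝ) * ρ ^ n := by
    refine hinj.tsum_eq (f := fun n => ((ebFib g n).card : ℝ) * ρ ^ n) ?_
    intro n hn
    by_contra h
    exact hn (hsupp2 n h)
  have hP := eb_prod g hg0 ρ hρ0 hρ1 hps
  refine ⟨hP.multipliable, ?_⟩
  rw [hP.tprod_eq, ← hpt]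
  refine hqt.congr fun m => ?_
  rw [eb_card g hg0]
  simp only [hq, hb]
  rw [mul_div_mul_right _ _ (by positivity)]
end

section
/- Fix an integer d ≥ 1 and non-negative integers (g_k)_{k≥1} with g_k = 0 unless d | k, such that g(z) = Σ_{k≥1} g_k z^k belongs to the class S_d with radius of convergence ρ ∈ (0,1). For n divisible by d admitting at least one multiset of total size n, let S_n be a uniformly random multiset of total size n, and define the remainder R_n as follows: let k* be the maximal size s(t) over types t with S_n(t) > 0, choose a type t₀ at random with probability proportional to S_n(t₀)·1{s(t₀) = k*}, and set R_n = S_n − δ_{t₀} (remove one element of maximal size). Then d_TV(R_n, R) → 0 as n → ∞ along multiples of d, where R is the Boltzmann random multiset with independent geometric coordinates. -/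
/-- The type of objects ("types"): `g k` distinct objects of each size `k`. -/
abbrev MTy (g : ℕ → ℕ) : Type := Σ k : ℕ, Fin (g k)

/-- The total size of a multiset `m : MTy g →₀ ℕ`: `∑_t m(t) · s(t)`, where the size of the
object `t = ⟨k, i⟩` is `s(t) = k`. -/
def msize (g : ℕ → ℕ) (m : MTy g →₀ ℕ) : ℕ := m.sum fun t c => c * t.1

/-- The point mass at `m` of the uniform distribution on multisets of total size `n`. -/
noncomputable def pUnif (g : ℕ → ℕ) (n : ℕ) (m : MTy g →₀ ℕ) : ℝ :=
  if msize g m = n then ((Nat.card {m' : MTy g →₀ ℕ // msize g m' = n} : ℝ))⁻¹ else 0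

/-- The point mass at `m` of the Boltzmann random multiset `R` with independent geometric
coordinates `ℙ(R(t) = j) = (1 - ρ^{s(t)}) ρ^{j s(t)}`: it equals
`(∏_t (1 - ρ^{s(t)})) · ρ^{|m|}`. -/
noncomputable def pBoltz (g : ℕ → ℕ) (ρ : ℝ) (m : MTy g →₀ ℕ) : ℝ :=
  (∏' t : MTy g, (1 - ρ ^ t.1)) * ρ ^ (msize g m)

/-- The total variation distance between two probability mass functions on a countable
state space: `sup_E |ℙ(X ∈ E) - ℙ(Y ∈ E)|`. -/
noncomputable def dTV {S : Type*} (p q : S → ℝ) : ℝ :=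
  ⨆ E : Set S, |(∑' x : E, p x) - ∑' x : E, q x|

/-- The maximal size of an object occurring in the multiset `m`. -/
def maxsize (g : ℕ → ℕ) (m : MTy g →₀ ℕ) : ℕ := m.support.sup fun t => t.1

/-- The point mass at `r` of the remainder `R_n` of a uniformly random multiset `S_n` of
total size `n`: a type `t₀` of maximal size is chosen with probability proportional to
`S_n(t₀)`, and one element of that type is removed. -/
noncomputable def pRem (g : ℕ → ℕ) (n : ℕ) (r : MTy g →₀ ℕ) : ℝ :=
  ∑' t : MTy g,
    if msize g (r + Finsupp.single t 1) = n ∧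
        t.1 = maxsize g (r + Finsupp.single t 1) then
      ((r t : ℝ) + 1) /
        ((Nat.card {m' : MTy g →₀ ℕ // msize g m' = n} : ℝ) *
          (∑ t' ∈ (r + Finsupp.single t 1).support,
            if t'.1 = maxsize g (r + Finsupp.single t 1) then
              ((((r + Finsupp.single t 1 : MTy g →₀ ℕ)) t' : ℕ) : ℝ)
            else 0))
    else 0

section RemAux
open Filter Topology Finset


lemma rt_shift_fwd (a : ℕ → ℝ) (N : ℕ) (hN : ∀ m, N ≤ m → 0 < a m)
    (hr : Tendsto (fun m => a m / a (m+1)) atTop (𝓝 1)) (j : ℕ) :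
    Tendsto (fun m => a m / a (m+j)) atTop (𝓝 1) := by
  induction j with
  | zero =>
    refine tendsto_const_nhds.congr' ?_
    filter_upwards [eventually_ge_atTop N] with m hm
    simp [(hN m hm).ne']
  | succ j ih =>
    have h2 := ih.mul (hr.comp (tendsto_add_atTop_nat j))
    rw [one_mul] at h2
    refine h2.congr' ?_
    filter_upwards [eventually_ge_atTop N] with m hm
    have h1 := (hN (m+j) (by omega)).ne'
    have h3 := (hN (m+j+1) (by omega)).ne'
    simp only [Function.comp]
    rw [← add_assoc]
    field_simp

lemma rt_shift (a : ℕ → ℝ) (N : ℕ) (hN : ∀ m, N ≤ m → 0 < a m)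
    (hr : Tendsto (fun m => a m / a (m+1)) atTop (𝓝 1)) (j : ℕ) :
    Tendsto (fun m => a (m-j) / a m) atTop (𝓝 1) := by
  refine ((rt_shift_fwd a N hN hr j).comp (tendsto_sub_atTop_nat j)).congr' ?_
  filter_upwards [eventually_ge_atTop j] with m hm
  simp [Nat.sub_add_cancel hm]

lemma rt_split (f : ℕ → ℝ) (K m : ℕ) (h : 2 * K ≤ m + 1) :
    ∑ k ∈ range (m+1), f k = ∑ k ∈ range K, f k + ∑ k ∈ Ico K (m+1-K), f k
      + ∑ k ∈ range K, f (m-k) := by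
  have h1 := Finset.sum_Ico_reflect f 0 (m := K) (n := m) (by omega)
  simp only [range_eq_Ico]
  rw [h1, Finset.sum_Ico_consecutive f (by omega) (by omega)]
  simp only [Nat.sub_zero]
  rw [Finset.sum_Ico_consecutive f (by omega) (by omega)]

lemma rt_mid (a : ℕ → ℝ) (N : ℕ) (hN : ∀ m, N ≤ m → 0 < a m)
    (hs : Summable a)
    (hr : Tendsto (fun m => a m / a (m+1)) atTop (𝓝 1))
    (hc : Tendsto (fun m => (∑ k ∈ range (m+1), a k * a (m-k)) / a m) atTop (𝓝 (2 * ∑' k, a k)))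
    (ε : ℝ) (hε : 0 < ε) :
    ∃ K0, ∀ K, K0 ≤ K → ∀ᶠ m in atTop,
      ∑ k ∈ Ico K (m+1-K), a k * a (m-k) ≤ ε * a m := by
  have h1 : ∀ᶠ K in atTop, 2 * ∑' k, a k - 2 * ∑ k ∈ range K, a k < ε := by
    have := ((hs.hasSum.tendsto_sum_nat.const_mul 2).const_sub (2 * ∑' k, a k))
    rw [sub_self] at this
    exact this.eventually_lt_const hε
  obtain ⟨K0, hK0⟩ := eventually_atTop.1 h1
  refine ⟨K0, fun K hK => ?_⟩
  have h2 : Tendsto (fun m => ∑ k ∈ range K, a k * (a (m-k) / a m)) atTop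
      (𝓝 (∑ k ∈ range K, a k * 1)) :=
    tendsto_finsetSum _ fun k _ => (rt_shift a N hN hr k).const_mul _
  simp only [mul_one] at h2
  have h3 := (hc.sub (h2.const_mul 2)).eventually_lt_const (hK0 K hK)
  filter_upwards [h3, eventually_ge_atTop N, eventually_ge_atTop (2*K)] with m hm hmN hmK
  have hp := hN m hmN
  rw [rt_split _ K m (by omega)] at hm
  have e1 : ∑ k ∈ range K, a (m-k) * a (m-(m-k)) = ∑ k ∈ range K, a k * a (m-k) := by
    refine sum_congr rfl fun k hk => ?_
    have := mem_range.1 hk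
    rw [Nat.sub_sub_self (by omega), mul_comm]
  have e2 : ∑ k ∈ range K, a k * (a (m-k) / a m) = (∑ k ∈ range K, a k * a (m-k)) / a m := by
    rw [Finset.sum_div]; exact sum_congr rfl fun k _ => by ring
  rw [e1, e2] at hm
  have e3 : (∑ k ∈ range K, a k * a (m - k) + ∑ k ∈ Ico K (m + 1 - K), a k * a (m - k) +
        ∑ k ∈ range K, a k * a (m - k)) / a m - 2 * ((∑ k ∈ range K, a k * a (m - k)) / a m)
      = (∑ k ∈ Ico K (m + 1 - K), a k * a (m - k)) / a m := by ring
  rw [e3, div_lt_iff₀ hp] at hm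
  exact hm.le

lemma rt_step (a β u : ℕ → ℝ) (ha : ∀ m, 0 ≤ a m) (hb : ∀ m, 0 ≤ β m) (hu : ∀ m, 0 ≤ u m)
    (N : ℕ) (hN : ∀ m, N ≤ m → 0 < a m)
    (hs : Summable a) (hsu : Summable u)
    (hr : Tendsto (fun m => a m / a (m+1)) atTop (𝓝 1))
    (hc : Tendsto (fun m => (∑ k ∈ range (m+1), a k * a (m-k)) / a m) atTop (𝓝 (2 * ∑' k, a k)))
    (hβ : Tendsto (fun m => β m / a m) atTop (𝓝 1))
    (hrec : ∀ m : ℕ, m * u m ≤ ∑ k ∈ range (m+1), k * β k * u (m-k))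
    (δ : ℝ) (hδ : 0 < δ) :
    ∃ K0, ∀ K, K0 ≤ K → ∀ᶠ m in atTop, ∀ C : ℝ, 0 ≤ C → (∀ j, K ≤ j → j < m → u j ≤ C * a j) →
      u m ≤ (∑' k, u k + δ + δ * C) * a m := by
  obtain ⟨K1, hK1⟩ := rt_mid a N hN hs hr hc (δ/4) (by positivity)
  obtain ⟨K2, hK2⟩ := eventually_atTop.1 (hβ.eventually_lt_const (show (1:ℝ) < 2 by norm_num))
  refine ⟨max (max K1 K2) (max N 1), fun K hK => ?_⟩
  have hKK1 : K1 ≤ K := by omega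
  have hKK2 : K2 ≤ K := by omega
  have hKN : N ≤ K := by omega
  have hK1' : 1 ≤ K := by omega
  have hβ2 : ∀ k, K ≤ k → β k ≤ 2 * a k := fun k hk => by
    have := hK2 k (by omega)
    rw [div_lt_iff₀ (hN k (by omega))] at this
    exact this.le
  -- part A
  have hA : ∀ᶠ m in atTop, ∑ j ∈ range K, β (m-j) * u j ≤ (∑' k, u k + δ) * a m := by
    have h2 : Tendsto (fun m => ∑ j ∈ range K, (β (m-j) / a (m-j)) * (a (m-j) / a m) * u j) atTop
      (𝓝 (∑ j ∈ range K, 1 * 1 * u j)) :=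
      tendsto_finsetSum _ fun k _ =>
        ((hβ.comp (tendsto_sub_atTop_nat k)).mul (rt_shift a N hN hr k)).mul_const _
    have h3 : ∑ j ∈ range K, 1 * 1 * u j < ∑' k, u k + δ := by
      have := hsu.sum_le_tsum (range K) (fun i _ => hu i)
      simp only [one_mul]; linarith
    filter_upwards [h2.eventually_lt_const h3, eventually_ge_atTop (N + K)] with m hm hmN
    have hp := hN m (by omega)
    have e : ∑ j ∈ range K, (β (m-j) / a (m-j)) * (a (m-j) / a m) * u j
      = (∑ j ∈ range K, β (m-j) * u j) / a m := by
      rw [Finset.sum_div]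
      refine sum_congr rfl fun j hj => ?_
      have := mem_range.1 hj
      have h1 := (hN (m-j) (by omega)).ne'
      field_simp
    rw [e, div_lt_iff₀ hp] at hm
    exact hm.le
  have hB : ∀ᶠ m : ℕ in atTop, ∑ k ∈ range K, (k / m : ℝ) * β k * a (m-k) ≤ (δ/2) * a m := by
    have h2 : Tendsto (fun m : ℕ => ∑ k ∈ range K, (k / m : ℝ) * β k * (a (m-k) / a m)) atTop
      (𝓝 (∑ k ∈ range K, 0 * β k * 1)) :=
      tendsto_finsetSum _ fun k _ =>
        ((tendsto_const_div_atTop_nhds_zero_nat (k:ℝ)).mul_const _).mul (rt_shift a N hN hr k)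
    simp only [zero_mul, sum_const_zero] at h2
    filter_upwards [h2.eventually_lt_const (half_pos hδ), eventually_ge_atTop N] with m hm hmN
    have hp := hN m (by omega)
    have e : ∑ k ∈ range K, (k / m : ℝ) * β k * (a (m-k) / a m)
      = (∑ k ∈ range K, (k / m : ℝ) * β k * a (m-k)) / a m := by
      rw [Finset.sum_div]
      exact sum_congr rfl fun j hj => by ring
    rw [e, div_lt_iff₀ hp] at hm
    exact hm.le
  filter_upwards [hA, hB, hK1 K hKK1, eventually_ge_atTop (2*K + N + 1)] with m hAm hBm hCm hm C hC hj
  have hp := hN m (by omega)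
  have hm0 : (0:ℝ) < m := by exact_mod_cast (by omega : 0 < m)
  have h1 : u m ≤ ∑ k ∈ range (m+1), (k / m : ℝ) * β k * u (m-k) := by
    have : ∑ k ∈ range (m+1), (k / m : ℝ) * β k * u (m-k)
      = (∑ k ∈ range (m+1), k * β k * u (m-k)) / m := by
      rw [Finset.sum_div]
      exact sum_congr rfl fun j hj => by ring
    rw [this, le_div_iff₀ hm0, mul_comm]
    exact hrec m
  rw [rt_split _ K m (by omega)] at h1
  have hfrac : ∀ k, k ≤ m → (k / m : ℝ) ≤ 1 := fun k hk => by
    rw [div_le_one hm0]; exact_mod_cast hk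
  have p1 : ∑ k ∈ range K, (k / m : ℝ) * β k * u (m-k) ≤ C * ((δ/2) * a m) := by
    refine le_trans ?_ (mul_le_mul_of_nonneg_left hBm hC)
    rw [mul_sum]
    refine sum_le_sum fun k hk => ?_
    have hkK := mem_range.1 hk
    rcases Nat.eq_zero_or_pos k with rfl | hk0
    · simp
    · have := hj (m-k) (by omega) (by omega)
      have h0 : 0 ≤ (k / m : ℝ) * β k := mul_nonneg (by positivity) (hb k)
      nlinarith [mul_le_mul_of_nonneg_left this h0]
  have p2 : ∑ k ∈ Ico K (m+1-K), (k / m : ℝ) * β k * u (m-k) ≤ 2 * C * (δ/4 * a m) := by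
    refine le_trans ?_ (mul_le_mul_of_nonneg_left hCm (by positivity))
    rw [mul_sum]
    refine sum_le_sum fun k hk => ?_
    have hkK := mem_Ico.1 hk
    have q1 := hj (m-k) (by omega) (by omega)
    have q2 := hβ2 k hkK.1
    have q3 := hfrac k (by omega)
    calc (k / m : ℝ) * β k * u (m-k) ≤ 1 * (2 * a k) * (C * a (m-k)) := by
          have := hb k
          have := hu (m-k)
          have := ha k
          gcongr
      _ = _ := by ring
  have p3 : ∑ k ∈ range K, ((m-k : ℕ) / m : ℝ) * β (m-k) * u (m-(m-k)) ≤ (∑' k, u k + δ) * a m := by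
    refine le_trans (sum_le_sum fun k hk => ?_) hAm
    have hkK := mem_range.1 hk
    rw [Nat.sub_sub_self (by omega)]
    have q3 := hfrac (m-k) (by omega)
    calc ((m-k : ℕ) / m : ℝ) * β (m-k) * u k ≤ 1 * β (m-k) * u k := by
          have := hb (m-k)
          have := hu k
          gcongr
      _ = _ := by ring
  linarith

lemma rt_main (a β u : ℕ → ℝ) (ha : ∀ m, 0 ≤ a m) (hb : ∀ m, 0 ≤ β m) (hu : ∀ m, 0 ≤ u m)
    (N : ℕ) (hN : ∀ m, N ≤ m → 0 < a m)
    (hs : Summable a) (hsu : Summable u)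
    (hr : Tendsto (fun m => a m / a (m+1)) atTop (𝓝 1))
    (hc : Tendsto (fun m => (∑ k ∈ range (m+1), a k * a (m-k)) / a m) atTop (𝓝 (2 * ∑' k, a k)))
    (hβ : Tendsto (fun m => β m / a m) atTop (𝓝 1))
    (hrec : ∀ m : ℕ, m * u m ≤ ∑ k ∈ range (m+1), k * β k * u (m-k))
    (δ : ℝ) (hδ : 0 < δ) :
    ∀ᶠ m in atTop, u m ≤ (∑' k, u k + δ) * a m := by
  have hU : 0 ≤ ∑' k, u k := tsum_nonneg hu
  obtain ⟨K, C, hC, hKC⟩ : ∃ K : ℕ, ∃ C : ℝ, 0 ≤ C ∧ ∀ j, K ≤ j → u j ≤ C * a j := by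
    obtain ⟨K0, hK0⟩ := rt_step a β u ha hb hu N hN hs hsu hr hc hβ hrec (1/2) (by norm_num)
    obtain ⟨m0, hm0⟩ := eventually_atTop.1 (hK0 (max K0 N) (le_max_left _ _))
    set C := 2 * (∑' k, u k + 1/2) + ∑ j ∈ range m0, u j / a j with hCdef
    have hS : 0 ≤ ∑ j ∈ range m0, u j / a j := sum_nonneg fun j _ => div_nonneg (hu j) (ha j)
    have hC : 0 ≤ C := by rw [hCdef]; linarith
    refine ⟨max K0 N, C, hC, fun j => ?_⟩
    induction j using Nat.strong_induction_on with
    | _ j ih =>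
      intro hj
      have hp := hN j (by omega)
      by_cases hjm : j < m0
      · have h1 : u j / a j ≤ ∑ j ∈ range m0, u j / a j :=
          single_le_sum (f := fun j => u j / a j) (fun j _ => div_nonneg (hu j) (ha j))
            (mem_range.2 hjm)
        rw [← div_le_iff₀ hp]
        linarith
      · have := hm0 j (by omega) C hC (fun i hi hij => ih i hij hi)
        refine this.trans ?_
        apply mul_le_mul_of_nonneg_right _ hp.le
        linarith
  set η := δ / (1 + C) with hη
  have hη0 : 0 < η := by positivity
  obtain ⟨K0, hK0⟩ := rt_step a β u ha hb hu N hN hs hsu hr hc hβ hrec η hη0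
  filter_upwards [hK0 (max K0 K) (le_max_left _ _)] with m hm
  have := hm C hC fun j hj _ => hKC j (by omega)
  have e : η + η * C = δ := by rw [hη]; field_simp
  rw [add_assoc, e] at this
  exact this

lemma msize_add (g : ℕ → ℕ) (a b : MTy g →₀ ℕ) : msize g (a + b) = msize g a + msize g b := by
  unfold msize
  exact Finsupp.sum_add_index' (by simp) (by intros; ring)

lemma msize_single (g : ℕ → ℕ) (t : MTy g) (i : ℕ) : msize g (Finsupp.single t i) = i * t.1 := by
  unfold msize
  exact Finsupp.sum_single_index (by simp)

lemma le_msize (g : ℕ → ℕ) (m : MTy g →₀ ℕ) (t : MTy g) : m t * t.1 ≤ msize g m := by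
  by_cases h : t ∈ m.support
  · exact Finset.single_le_sum (f := fun t : MTy g => m t * t.1) (fun _ _ => Nat.zero_le _) h
  · simp [Finsupp.notMem_support_iff.1 h]

lemma ty_pos (g : ℕ → ℕ) (hg0 : g 0 = 0) (t : MTy g) : 1 ≤ t.1 := by
  obtain ⟨k, i⟩ := t
  rcases Nat.eq_zero_or_pos k with rfl | h
  · have := i.2; omega
  · exact h

lemma boltz_fin (g : ℕ → ℕ) (hg0 : g 0 = 0) (ρ : ℝ) (h0 : 0 < ρ) (h1 : ρ < 1) (F : Finset (MTy g)) :
    HasSum (fun r : MTy g →₀ ℕ => if r.support ⊆ F then ρ ^ msize g r else 0)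
      (∏ t ∈ F, (1 - ρ ^ t.1)⁻¹) := by
  classical
  induction F using Finset.induction_on with
  | empty =>
    simp only [Finset.prod_empty]
    have : (1:ℝ) = (fun r : MTy g →₀ ℕ => if r.support ⊆ ∅ then ρ ^ msize g r else 0) 0 := by
      simp [msize]
    rw [this]
    apply hasSum_single
    intro r hr
    rw [if_neg]
    rw [Finset.subset_empty]
    simpa using hr
  | insert t F ht ih =>
    have hlt : ρ ^ t.1 < 1 := pow_lt_one₀ h0.le h1 (by have := ty_pos g hg0 t; omega)
    have hgeo := hasSum_geometric_of_lt_one (by positivity) hlt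
    have hnn : ∀ r : MTy g →₀ ℕ, 0 ≤ (if r.support ⊆ F then ρ ^ msize g r else 0) := fun r => by
      split_ifs <;> positivity
    have hprod := ih.mul hgeo (ih.summable.mul_of_nonneg hgeo.summable hnn
      (fun i => by positivity))
    rw [Finset.prod_insert ht, mul_comm]
    have hsup : ∀ x : (MTy g →₀ ℕ) × ℕ, (if x.1.support ⊆ F then ρ ^ msize g x.1 else 0) *
        (ρ ^ t.1) ^ x.2 ≠ 0 → x.1.support ⊆ F := by
      intro x hx
      by_contra h
      simp [h] at hx
    refine (hasSum_iff_hasSum_of_ne_zero_bij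
      (fun x : Function.support (fun x : (MTy g →₀ ℕ) × ℕ =>
        (if x.1.support ⊆ F then ρ ^ msize g x.1 else 0) * (ρ ^ t.1) ^ x.2) =>
        x.1.1 + Finsupp.single t x.1.2) ?_ ?_ ?_).2 hprod
    · rintro ⟨⟨r, i⟩, hx⟩ ⟨⟨r', i'⟩, hx'⟩ h
      have e1 := hsup _ hx
      have e2 := hsup _ hx'
      simp only at e1 e2 h
      have z1 : r t = 0 := Finsupp.notMem_support_iff.1 fun h => ht (e1 h)
      have z2 : r' t = 0 := Finsupp.notMem_support_iff.1 fun h => ht (e2 h)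
      have hi : i = i' := by
        have := DFunLike.congr_fun h t
        simpa [z1, z2] using this
      subst hi
      have hr := add_right_cancel h
      subst hr
      rfl
    · intro r hr
      have hr' : r.support ⊆ insert t F := by
        by_contra h
        simp [h] at hr
      have hF : (r.erase t).support ⊆ F := by
        rw [Finsupp.support_erase]
        intro x hx
        have := Finset.mem_erase.1 hx
        exact Finset.mem_of_mem_insert_of_ne (hr' this.2) this.1
      refine ⟨⟨(r.erase t, r t), ?_⟩, ?_⟩
      · simp only [Function.mem_support, hF, if_true]
        positivity
      · exact Finsupp.erase_add_single t r
    · rintro ⟨⟨r, i⟩, hx⟩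
      have e1 := hsup _ hx
      simp only at e1
      have : (r + Finsupp.single t i).support ⊆ insert t F := by
        refine Finsupp.support_add.trans ?_
        refine Finset.union_subset (e1.trans (Finset.subset_insert _ _)) ?_
        exact Finsupp.support_single_subset.trans (by simp)
      simp only [this, e1, if_true, msize_add, msize_single]
      rw [pow_add, ← pow_mul, mul_comm t.1 i]

lemma summable_ty (g : ℕ → ℕ) (ρ : ℝ) (h0 : 0 < ρ) (hs : Summable fun n => (g n : ℝ) * ρ ^ n) :
    Summable (fun t : MTy g => ρ ^ t.1) := by
  rw [summable_sigma_of_nonneg (fun t => by positivity)]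
  refine ⟨fun k => (hasSum_fintype _).summable, ?_⟩
  simpa [tsum_fintype] using hs

lemma boltz_hasSum (g : ℕ → ℕ) (hg0 : g 0 = 0) (ρ : ℝ) (h0 : 0 < ρ) (h1 : ρ < 1)
    (hs : Summable fun n => (g n : ℝ) * ρ ^ n) :
    ∃ U : ℝ, 0 < U ∧ HasSum (fun r : MTy g →₀ ℕ => ρ ^ msize g r) U ∧
      (∏' t : MTy g, (1 - ρ ^ t.1)) = U⁻¹ := by
  classical
  have hty := summable_ty g ρ h0 hs
  have hlt : ∀ t : MTy g, ρ ^ t.1 ≤ ρ := fun t => by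
    have := ty_pos g hg0 t
    exact pow_le_of_le_one h0.le h1.le (by omega)
  have hM1 : Multipliable (fun t : MTy g => 1 - ρ ^ t.1) := by
    have : Multipliable (fun t : MTy g => 1 + (- ρ ^ t.1)) :=
      multipliable_one_add_of_summable (by simpa [abs_of_pos h0] using hty)
    simpa [sub_eq_add_neg] using this
  have hM2 : Multipliable (fun t : MTy g => (1 - ρ ^ t.1)⁻¹) := by
    have : Multipliable (fun t : MTy g => 1 + (ρ ^ t.1 * (1 - ρ ^ t.1)⁻¹)) := by
      apply multipliable_one_add_of_summable
      refine Summable.of_nonneg_of_le (fun _ => norm_nonneg _) (fun t => ?_)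
        (hty.mul_right (1-ρ)⁻¹)
      have := hlt t
      have h2 : 0 < 1 - ρ ^ t.1 := by linarith
      rw [Real.norm_of_nonneg (by positivity)]
      have : 0 < 1 - ρ := by linarith
      gcongr
    refine this.congr fun t => ?_
    have := hlt t
    have h2 : 1 - ρ ^ t.1 ≠ 0 := by linarith
    field_simp
    ring
  have hPQ := hM1.hasProd.mul hM2.hasProd
  have hone : (fun t : MTy g => (1 - ρ ^ t.1) * (1 - ρ ^ t.1)⁻¹) = fun _ => 1 := by
    funext t
    have := hlt t
    exact mul_inv_cancel₀ (by linarith)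
  rw [hone] at hPQ
  have hPQ1 := hPQ.unique hasProd_one
  set P := ∏' t : MTy g, (1 - ρ ^ t.1)
  set Q := ∏' t : MTy g, (1 - ρ ^ t.1)⁻¹
  have hQt : Tendsto (fun F : Finset (MTy g) => ∏ t ∈ F, (1 - ρ ^ t.1)⁻¹) atTop (𝓝 Q) := hM2.hasProd
  have hmono : Monotone (fun F : Finset (MTy g) => ∏ t ∈ F, (1 - ρ ^ t.1)⁻¹) := by
    intro F F' hF
    refine hasSum_le (fun r => ?_) (boltz_fin g hg0 ρ h0 h1 F) (boltz_fin g hg0 ρ h0 h1 F')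
    by_cases h : r.support ⊆ F
    · simp [h, h.trans hF]
    · simp only [h, if_false]; split_ifs <;> positivity
  have hle : ∀ F : Finset (MTy g), ∏ t ∈ F, (1 - ρ ^ t.1)⁻¹ ≤ Q := fun F => hmono.ge_of_tendsto hQt F
  have hbd : ∀ E : Finset (MTy g →₀ ℕ), ∑ r ∈ E, ρ ^ msize g r ≤ Q := by
    intro E
    refine le_trans ?_ (hle (E.biUnion fun r => r.support))
    have := sum_le_hasSum E (fun r _ => by split_ifs <;> positivity)
      (boltz_fin g hg0 ρ h0 h1 (E.biUnion fun r => r.support))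
    refine le_trans (le_of_eq ?_) this
    refine Finset.sum_congr rfl fun r hr => ?_
    rw [if_pos]
    exact Finset.subset_biUnion_of_mem (fun r : MTy g →₀ ℕ => r.support) hr
  have hsm : Summable (fun r : MTy g →₀ ℕ => ρ ^ msize g r) :=
    summable_of_sum_le (fun r => by positivity) hbd
  have hUQ : ∑' r : MTy g →₀ ℕ, ρ ^ msize g r = Q := by
    apply le_antisymm
    · exact hsm.tsum_le_of_sum_le hbd
    · refine le_of_tendsto' hQt fun F => ?_
      refine hasSum_le (fun r => ?_) (boltz_fin g hg0 ρ h0 h1 F) hsm.hasSum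
      split_ifs
      · exact le_rfl
      · positivity
  refine ⟨Q, ?_, hUQ ▸ hsm.hasSum, eq_inv_of_mul_eq_one_left hPQ1⟩
  have := hle ∅
  simp at this
  linarith


/-- types of size at most n -/
def tyLe (g : ℕ → ℕ) (n : ℕ) : Finset (MTy g) := (range (n+1)).sigma fun _ => Finset.univ

lemma mem_tyLe (g : ℕ → ℕ) (n : ℕ) (t : MTy g) : t ∈ tyLe g n ↔ t.1 ≤ n := by
  simp [tyLe]

lemma coord_le (g : ℕ → ℕ) (hg0 : g 0 = 0) (m : MTy g →₀ ℕ) (t : MTy g) : m t ≤ msize g m := by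
  have h1 := le_msize g m t
  have h2 := ty_pos g hg0 t
  nlinarith

lemma supp_le (g : ℕ → ℕ) (m : MTy g →₀ ℕ) (t : MTy g) (h : m t ≠ 0) : t.1 ≤ msize g m := by
  have h1 := le_msize g m t
  have : 1 ≤ m t := by omega
  nlinarith

lemma finite_le (g : ℕ → ℕ) (hg0 : g 0 = 0) (n : ℕ) : {m : MTy g →₀ ℕ | msize g m ≤ n}.Finite := by
  classical
  refine (Set.finite_Icc (0 : MTy g →₀ ℕ) (Finsupp.indicator (tyLe g n) fun _ _ => n)).subset ?_
  intro m hm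
  simp only [Set.mem_ofPred_eq] at hm
  refine ⟨zero_le, fun t => ?_⟩
  rw [Finsupp.indicator_apply]
  split_ifs with h
  · exact (coord_le g hg0 m t).trans hm
  · by_contra h2
    exact h ((mem_tyLe g n t).2 ((supp_le g m t (by omega)).trans hm))

lemma finite_eq (g : ℕ → ℕ) (hg0 : g 0 = 0) (n : ℕ) : {m : MTy g →₀ ℕ | msize g m = n}.Finite :=
  (finite_le g hg0 n).subset fun _ h => le_of_eq h

/-- number of multisets of size n -/
noncomputable def cN (g : ℕ → ℕ) (n : ℕ) : ℕ := Nat.card {m' : MTy g →₀ ℕ // msize g m' = n}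

/-- finset of multisets of size n -/
noncomputable def XN (g : ℕ → ℕ) (hg0 : g 0 = 0) (n : ℕ) : Finset (MTy g →₀ ℕ) :=
  (finite_eq g hg0 n).toFinset

lemma mem_XN (g : ℕ → ℕ) (hg0 : g 0 = 0) (n : ℕ) (m : MTy g →₀ ℕ) :
    m ∈ XN g hg0 n ↔ msize g m = n := by simp [XN]

lemma card_XN (g : ℕ → ℕ) (hg0 : g 0 = 0) (n : ℕ) : (XN g hg0 n).card = cN g n := by
  unfold cN XN
  exact (Nat.card_eq_card_finite_toFinset (finite_eq g hg0 n)).symm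

lemma cN_pos (g : ℕ → ℕ) (hg0 : g 0 = 0) (n : ℕ) (h : 0 < g n) : 0 < cN g n := by
  rw [← card_XN g hg0, Finset.card_pos]
  exact ⟨Finsupp.single ⟨n, ⟨0, h⟩⟩ 1, by rw [mem_XN, msize_single]; simp⟩

lemma card_filter_le (g : ℕ → ℕ) (hg0 : g 0 = 0) (n i : ℕ) (t : MTy g) :
    ((XN g hg0 n).filter fun m => i ≤ m t).card ≤ if i * t.1 ≤ n then cN g (n - i * t.1) else 0 := by
  classical
  split_ifs with h
  · rw [← card_XN g hg0]
    refine Finset.card_le_card_of_injOn (fun m => m - Finsupp.single t i) ?_ ?_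
    · intro m hm
      simp only [Finset.coe_filter, Set.mem_ofPred_eq, mem_XN] at hm
      have h2 : m - Finsupp.single t i + Finsupp.single t i = m :=
        tsub_add_cancel_of_le (Finsupp.single_le_iff.2 hm.2)
      have h3 := congrArg (msize g) h2
      rw [msize_add, msize_single] at h3
      simp only [Finset.mem_coe, mem_XN]
      omega
    · intro m hm m' hm' he
      simp only [Finset.coe_filter, Set.mem_ofPred_eq, mem_XN] at hm hm'
      have h2 : m - Finsupp.single t i + Finsupp.single t i = m :=
        tsub_add_cancel_of_le (Finsupp.single_le_iff.2 hm.2)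
      have h3 : m' - Finsupp.single t i + Finsupp.single t i = m' :=
        tsub_add_cancel_of_le (Finsupp.single_le_iff.2 hm'.2)
      simp only at he
      rw [← h2, ← h3, he]
  · rw [Nat.le_zero, Finset.card_eq_zero, Finset.filter_eq_empty_iff]
    intro m hm hi
    rw [mem_XN] at hm
    have := le_msize g m t
    have := Nat.mul_le_mul_right t.1 hi
    omega

/-- divisor-type sum -/
def Bd (g : ℕ → ℕ) (k : ℕ) : ℕ := ∑ j ∈ k.divisors, j * g j

lemma inner_le (f : ℕ → ℕ) (n j : ℕ) (hj : 1 ≤ j) :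
    ∑ i ∈ Icc 1 n, (if i * j ≤ n then f (n - i * j) else 0) ≤
      ∑ k ∈ range (n+1), if j ∈ k.divisors then f (n - k) else 0 := by
  classical
  rw [← Finset.sum_filter, ← Finset.sum_filter]
  have : ∑ i ∈ (Icc 1 n).filter (fun i => i * j ≤ n), f (n - i * j)
      = ∑ k ∈ ((Icc 1 n).filter (fun i => i * j ≤ n)).image (fun i => i * j), f (n - k) := by
    rw [Finset.sum_image]
    intro a _ b _ h
    exact Nat.eq_of_mul_eq_mul_right hj h
  rw [this]
  refine Finset.sum_le_sum_of_subset ?_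
  intro k hk
  simp only [Finset.mem_image, Finset.mem_filter, Finset.mem_Icc] at hk
  obtain ⟨i, ⟨⟨h1, h2⟩, h3⟩, rfl⟩ := hk
  simp only [Finset.mem_filter, Finset.mem_range, Nat.mem_divisors]
  refine ⟨by omega, Dvd.intro_left _ rfl, ?_⟩
  have := Nat.mul_pos h1 hj
  omega

lemma cN_rec (g : ℕ → ℕ) (hg0 : g 0 = 0) (n : ℕ) :
    n * cN g n ≤ ∑ k ∈ range (n+1), Bd g k * cN g (n - k) := by
  classical
  have h1 : n * cN g n = ∑ m ∈ XN g hg0 n, ∑ t ∈ tyLe g n, m t * t.1 := by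
    rw [← card_XN g hg0, mul_comm, ← smul_eq_mul, ← Finset.sum_const]
    refine Finset.sum_congr rfl fun m hm => ?_
    rw [mem_XN] at hm
    have : msize g m = ∑ t ∈ tyLe g n, m t * t.1 := by
      unfold msize
      refine Finsupp.sum_of_support_subset _ ?_ _ (by simp)
      intro t ht
      rw [mem_tyLe, ← hm]
      exact supp_le g m t (Finsupp.mem_support_iff.1 ht)
    omega
  have h2 : ∀ t : MTy g, ∑ m ∈ XN g hg0 n, m t * t.1 ≤
      t.1 * ∑ i ∈ Icc 1 n, if i * t.1 ≤ n then cN g (n - i * t.1) else 0 := by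
    intro t
    rw [← Finset.sum_mul, mul_comm]
    refine Nat.mul_le_mul_left _ ?_
    have : ∑ m ∈ XN g hg0 n, m t = ∑ i ∈ Icc 1 n, ((XN g hg0 n).filter fun m => i ≤ m t).card := by
      simp only [Finset.card_filter]
      rw [Finset.sum_comm]
      refine Finset.sum_congr rfl fun m hm => ?_
      rw [mem_XN] at hm
      rw [← Finset.card_filter]
      have hle := coord_le g hg0 m t
      have : (Icc 1 n).filter (fun i => i ≤ m t) = Icc 1 (m t) := by
        ext i; simp only [Finset.mem_filter, Finset.mem_Icc]; omega
      rw [this]; simp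
    rw [this]
    exact Finset.sum_le_sum fun i _ => card_filter_le g hg0 n i t
  have h3 : n * cN g n ≤ ∑ j ∈ range (n+1), g j * (j * ∑ i ∈ Icc 1 n,
      if i * j ≤ n then cN g (n - i * j) else 0) := by
    rw [h1, Finset.sum_comm]
    refine (Finset.sum_le_sum fun t _ => h2 t).trans ?_
    unfold tyLe
    rw [Finset.sum_sigma]
    simp
  have h4 : ∑ k ∈ range (n+1), Bd g k * cN g (n - k) = ∑ j ∈ range (n+1), g j * (j *
      ∑ k ∈ range (n+1), if j ∈ k.divisors then cN g (n - k) else 0) := by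
    simp only [Finset.mul_sum]
    rw [Finset.sum_comm]
    refine Finset.sum_congr rfl fun k hk => ?_
    have hk := Finset.mem_range.1 hk
    unfold Bd
    rw [Finset.sum_mul]
    have hsub : k.divisors ⊆ range (n+1) := fun j hj => by
      have := Nat.divisor_le hj
      exact Finset.mem_range.2 (by omega)
    rw [← Finset.sum_subset hsub (f := fun j => g j * (j * if j ∈ k.divisors then cN g (n - k) else 0))]
    · refine Finset.sum_congr rfl fun j hj => ?_
      rw [if_pos hj]; ring
    · intro j _ hj
      simp [hj]
  rw [h4]
  refine h3.trans (Finset.sum_le_sum fun j _ => ?_)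
  rcases Nat.eq_zero_or_pos j with rfl | hj
  · simp
  · exact Nat.mul_le_mul_left _ (Nat.mul_le_mul_left _ (inner_le (cN g) n j hj))

/-- weight of the pair (m,t) -/
noncomputable def wt (g : ℕ → ℕ) (n : ℕ) (m : MTy g →₀ ℕ) (t : MTy g) : ℝ :=
  if msize g m = n ∧ t.1 = maxsize g m then
    (m t : ℝ) / ((cN g n : ℝ) * (∑ t' ∈ m.support, if t'.1 = maxsize g m then ((m t' : ℕ) : ℝ) else 0))
  else 0

lemma wt_nonneg (g : ℕ → ℕ) (n : ℕ) (m : MTy g →₀ ℕ) (t : MTy g) : 0 ≤ wt g n m t := by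
  unfold wt
  split_ifs
  · refine div_nonneg (Nat.cast_nonneg _) (mul_nonneg (Nat.cast_nonneg _) (Finset.sum_nonneg ?_))
    intro t' _
    split_ifs <;> simp
  · rfl

lemma pRem_eq (g : ℕ → ℕ) (n : ℕ) (r : MTy g →₀ ℕ) :
    pRem g n r = ∑ t ∈ tyLe g n, wt g n (r + Finsupp.single t 1) t := by
  have h : pRem g n r = ∑' t : MTy g, wt g n (r + Finsupp.single t 1) t := by
    unfold pRem wt cN
    refine tsum_congr fun t => ?_
    have : (((r + Finsupp.single t 1 : MTy g →₀ ℕ) t : ℕ) : ℝ) = (r t : ℝ) + 1 := by simp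
    rw [this]
  rw [h]
  refine tsum_eq_sum fun t ht => ?_
  rw [mem_tyLe] at ht
  unfold wt
  rw [if_neg]
  rintro ⟨h1, -⟩
  rw [msize_add, msize_single] at h1
  omega

lemma pRem_nonneg (g : ℕ → ℕ) (n : ℕ) (r : MTy g →₀ ℕ) : 0 ≤ pRem g n r := by
  rw [pRem_eq]
  exact Finset.sum_nonneg fun t _ => wt_nonneg _ _ _ _

lemma wt_sum_le (g : ℕ → ℕ) (n : ℕ) (m : MTy g →₀ ℕ) (F : Finset (MTy g)) :
    ∑ t ∈ F, wt g n m t ≤ (cN g n : ℝ)⁻¹ := by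
  classical
  by_cases hm : msize g m = n
  swap
  · simp [wt, hm]
  set D := ∑ t' ∈ m.support, if t'.1 = maxsize g m then ((m t' : ℕ) : ℝ) else 0 with hD
  have hD0 : 0 ≤ D := Finset.sum_nonneg fun t _ => by split_ifs <;> simp
  have h1 : ∀ t, wt g n m t = (if t.1 = maxsize g m then ((m t : ℕ) : ℝ) else 0) / (cN g n * D) := by
    intro t
    unfold wt
    rw [← hD]
    by_cases h : t.1 = maxsize g m <;> simp [hm, h]
  simp only [h1]
  rw [← Finset.sum_div]
  have h2 : ∑ t ∈ F, (if t.1 = maxsize g m then ((m t : ℕ) : ℝ) else 0) ≤ D := by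
    have e : ∑ t ∈ F, (if t.1 = maxsize g m then ((m t : ℕ) : ℝ) else 0)
        = ∑ t ∈ F ∩ m.support, (if t.1 = maxsize g m then ((m t : ℕ) : ℝ) else 0) := by
      refine (Finset.sum_subset Finset.inter_subset_left fun t ht hn => ?_).symm
      have : m t = 0 := by
        by_contra h
        exact hn (Finset.mem_inter.2 ⟨ht, Finsupp.mem_support_iff.2 h⟩)
      simp [this]
    rw [e]
    exact Finset.sum_le_sum_of_subset_of_nonneg Finset.inter_subset_right
      fun t _ _ => by split_ifs <;> simp
  calc _ ≤ D / (cN g n * D) := by gcongr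
    _ ≤ _ := by
      rcases hD0.eq_or_lt with h | h
      · rw [← h]; simp
      · rw [mul_comm, div_mul_eq_div_div, div_self h.ne', one_div]

lemma pRem_hasSum (g : ℕ → ℕ) (hg0 : g 0 = 0) (n : ℕ) :
    ∃ s : ℝ, s ≤ 1 ∧ HasSum (pRem g n) s := by
  classical
  set Y := (finite_le g hg0 n).toFinset with hY
  refine ⟨∑ r ∈ Y, pRem g n r, ?_, hasSum_sum_of_ne_finset_zero ?_⟩
  · simp only [pRem_eq]
    rw [← Finset.sum_product']
    have hinj : Set.InjOn (fun x : (MTy g →₀ ℕ) × MTy g => (x.1 + Finsupp.single x.2 1, x.2))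
        (Y ×ˢ tyLe g n : Finset _) := by
      rintro ⟨r, t⟩ - ⟨r', t'⟩ - h
      simp only [Prod.mk.injEq] at h
      obtain ⟨h1, rfl⟩ := h
      rw [add_right_cancel h1]
    rw [← Finset.sum_image (f := fun x : (MTy g →₀ ℕ) × MTy g => wt g n x.1 x.2) hinj]
    have : ∑ x ∈ XN g hg0 n ×ˢ tyLe g n, wt g n x.1 x.2 ≤ 1 := by
      rw [Finset.sum_product]
      refine (Finset.sum_le_sum fun m _ => wt_sum_le g n m _).trans ?_
      rw [Finset.sum_const, card_XN, nsmul_eq_mul]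
      exact mul_inv_le_one
    refine le_trans ?_ this
    rw [← Finset.sum_filter_ne_zero]
    refine Finset.sum_le_sum_of_subset_of_nonneg ?_ fun x _ _ => wt_nonneg _ _ _ _
    rintro ⟨m, t⟩ hx
    obtain ⟨hx, hne⟩ := Finset.mem_filter.1 hx
    obtain ⟨⟨r, t'⟩, h1, h2⟩ := Finset.mem_image.1 hx
    simp only [Prod.mk.injEq] at h2
    obtain ⟨h2, rfl⟩ := h2
    rw [Finset.mem_product] at h1 ⊢
    refine ⟨?_, h1.2⟩
    rw [mem_XN]
    by_contra h
    exact hne (by simp [wt, h])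
  · intro r hr
    rw [pRem_eq]
    refine Finset.sum_eq_zero fun t _ => ?_
    unfold wt
    rw [if_neg]
    rintro ⟨h1, -⟩
    rw [msize_add] at h1
    apply hr
    simp [hY]
    omega

lemma pRem_lower (g : ℕ → ℕ) (n : ℕ) (r : MTy g →₀ ℕ) (hn : 2 * msize g r < n) :
    (g (n - msize g r) : ℝ) / cN g n ≤ pRem g n r := by
  classical
  rw [pRem_eq]
  unfold tyLe
  rw [Finset.sum_sigma]
  have hterm : ∀ i : Fin (g (n - msize g r)),
      wt g n (r + Finsupp.single ⟨n - msize g r, i⟩ 1) ⟨n - msize g r, i⟩ = (cN g n : ℝ)⁻¹ := by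
    intro i
    set t : MTy g := ⟨n - msize g r, i⟩ with ht
    have ht1 : t.1 = n - msize g r := rfl
    have hsm : ∀ t' : MTy g, r t' ≠ 0 → t'.1 < t.1 := fun t' h => by
      have := supp_le g r t' h
      omega
    have hrt : r t = 0 := by
      by_contra h
      exact lt_irrefl _ (hsm t h)
    have hmt : (r + Finsupp.single t 1 : MTy g →₀ ℕ) t = 1 := by simp [hrt]
    have hmt' : ∀ t', t' ≠ t → (r + Finsupp.single t 1 : MTy g →₀ ℕ) t' = r t' := fun t' h => by
      simp [h.symm]
    have hmem : t ∈ (r + Finsupp.single t 1).support := by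
      rw [Finsupp.mem_support_iff, hmt]; exact one_ne_zero
    have hmax : maxsize g (r + Finsupp.single t 1) = t.1 := by
      unfold maxsize
      apply le_antisymm
      · refine Finset.sup_le fun t' ht' => ?_
        by_cases h : t' = t
        · rw [h]
        · rw [Finsupp.mem_support_iff, hmt' t' h] at ht'
          exact (hsm t' ht').le
      · exact Finset.le_sup (f := fun t : MTy g => t.1) hmem
    have hsz : msize g (r + Finsupp.single t 1) = n := by
      rw [msize_add, msize_single]; omega
    unfold wt
    rw [if_pos ⟨hsz, hmax.symm⟩, hmax, Finset.sum_eq_single t, if_pos rfl, hmt]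
    · simp
    · intro t' h1 h2
      rw [if_neg]
      rw [Finsupp.mem_support_iff, hmt' t' h2] at h1
      exact (hsm t' h1).ne
    · exact fun h => absurd hmem h
  have := Finset.single_le_sum (s := range (n+1))
    (f := fun j => ∑ i : Fin (g j), wt g n (r + Finsupp.single ⟨j, i⟩ 1) ⟨j, i⟩)
    (fun j _ => Finset.sum_nonneg fun i _ => wt_nonneg _ _ _ _)
    (Finset.mem_range.2 (by omega : n - msize g r < n + 1))
  refine le_trans (le_of_eq ?_) this
  simp only [hterm]
  simp [div_eq_mul_inv]

lemma sum_mult (d : ℕ) (hd : 1 ≤ d) (f : ℕ → ℝ) (hf : ∀ n, ¬ d ∣ n → f n = 0) (m : ℕ) :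
    ∑ k ∈ range (d*m+1), f k = ∑ l ∈ range (m+1), f (d*l) := by
  classical
  have hinj : Function.Injective (fun l : ℕ => d * l) := fun a b h => Nat.eq_of_mul_eq_mul_left hd h
  rw [← Finset.sum_image (f := f) (g := fun l => d * l) hinj.injOn]
  symm
  refine Finset.sum_subset ?_ ?_
  · intro k hk
    obtain ⟨l, hl, rfl⟩ := Finset.mem_image.1 hk
    have := Finset.mem_range.1 hl
    have := Nat.mul_le_mul_left d (show l ≤ m by omega)
    exact Finset.mem_range.2 (by omega)
  · intro k hk hn
    apply hf
    rintro ⟨l, rfl⟩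
    apply hn
    refine Finset.mem_image.2 ⟨l, ?_, rfl⟩
    have := Finset.mem_range.1 hk
    have : d * l ≤ d * m := by omega
    have := Nat.le_of_mul_le_mul_left this hd
    exact Finset.mem_range.2 (by omega)

lemma Bd_zero (d : ℕ) (g : ℕ → ℕ) (hz : ∀ n, ¬ d ∣ n → g n = 0) (k : ℕ) (hk : ¬ d ∣ k) :
    Bd g k = 0 := by
  refine Finset.sum_eq_zero fun j hj => ?_
  rw [hz j fun h => hk (h.trans (Nat.dvd_of_mem_divisors hj)), mul_zero]

lemma Bd_lower (g : ℕ → ℕ) (n : ℕ) (hn : n ≠ 0) : n * g n ≤ Bd g n :=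
  Finset.single_le_sum (f := fun j => j * g j) (fun _ _ => Nat.zero_le _)
    (Nat.mem_divisors_self n hn)

lemma Bd_upper (g : ℕ → ℕ) (ρ : ℝ) (h0 : 0 < ρ) (h1 : ρ < 1)
    (hs : Summable fun n => (g n : ℝ) * ρ ^ n) (n : ℕ) (hn : n ≠ 0) :
    (Bd g n : ℝ) / n * ρ ^ n ≤ g n * ρ ^ n + (∑' k, (g k : ℝ) * ρ ^ k) * (√ρ) ^ n := by
  have hn0 : (0:ℝ) < n := by exact_mod_cast Nat.pos_of_ne_zero hn
  have hB : (Bd g n : ℝ) = n * g n + ∑ j ∈ n.properDivisors, (j:ℝ) * g j := by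
    unfold Bd
    rw [← Nat.cons_self_properDivisors hn, Finset.sum_cons]
    push_cast; rfl
  rw [hB, add_div, add_mul, mul_div_cancel_left₀ _ hn0.ne']
  apply add_le_add le_rfl
  have hsq1 : √ρ ≤ 1 := Real.sqrt_le_one.2 h1.le
  have key : ∀ j ∈ n.properDivisors, (j:ℝ) * g j / n * ρ ^ n ≤ (g j * ρ ^ j) * (√ρ) ^ n := by
    intro j hj
    rw [Nat.mem_properDivisors] at hj
    obtain ⟨⟨c, hc⟩, hlt⟩ := hj
    have h2 : 2 * j ≤ n := by
      have : 2 ≤ c := by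
        by_contra h
        have : c = 0 ∨ c = 1 := by omega
        rcases this with rfl | rfl <;> simp at hc <;> omega
      nlinarith
    have e1 : (j:ℝ) * g j / n ≤ g j := by
      rw [div_le_iff₀ hn0, mul_comm]
      have : (j:ℝ) ≤ n := by exact_mod_cast hlt.le
      gcongr
    have e2 : ρ ^ n ≤ ρ ^ j * (√ρ) ^ n := by
      have : ρ ^ n = ρ ^ j * ρ ^ (n - j) := by rw [← pow_add]; congr 1; omega
      rw [this]
      gcongr
      calc ρ ^ (n-j) = (√ρ) ^ (2 * (n-j)) := by rw [pow_mul, Real.sq_sqrt h0.le]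
        _ ≤ _ := pow_le_pow_of_le_one (Real.sqrt_nonneg _) hsq1 (by omega)
    calc _ ≤ (g j : ℝ) * (ρ ^ j * (√ρ) ^ n) := by gcongr
      _ = _ := by ring
  calc (∑ j ∈ n.properDivisors, (j:ℝ) * g j) / n * ρ ^ n
      = ∑ j ∈ n.properDivisors, (j:ℝ) * g j / n * ρ ^ n := by rw [Finset.sum_div, Finset.sum_mul]
    _ ≤ ∑ j ∈ n.properDivisors, (g j * ρ ^ j) * (√ρ) ^ n := Finset.sum_le_sum key
    _ = (∑ j ∈ n.properDivisors, (g j * ρ ^ j)) * (√ρ) ^ n := by rw [Finset.sum_mul]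
    _ ≤ _ := mul_le_mul_of_nonneg_right (hs.sum_le_tsum _ fun i _ => by positivity)
      (by positivity)

lemma cN_hasSum (g : ℕ → ℕ) (hg0 : g 0 = 0) (ρ U : ℝ)
    (hU : HasSum (fun r : MTy g →₀ ℕ => ρ ^ msize g r) U) :
    HasSum (fun n => (cN g n : ℝ) * ρ ^ n) U := by
  have h := (Equiv.hasSum_iff (Equiv.sigmaFiberEquiv (msize g))).2 hU
  refine h.sigma fun n => ?_
  have : Finite {r : MTy g →₀ ℕ // msize g r = n} := finite_eq g hg0 n
  have := Fintype.ofFinite {r : MTy g →₀ ℕ // msize g r = n}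
  have e : (cN g n : ℝ) * ρ ^ n = ∑ c : {r : MTy g →₀ ℕ // msize g r = n}, ρ ^ n := by
    rw [Finset.sum_const, nsmul_eq_mul, Finset.card_univ, cN, Nat.card_eq_fintype_card]
  rw [e]
  convert hasSum_fintype (fun c : {r : MTy g →₀ ℕ // msize g r = n} => ρ ^ n) using 2 with c
  simp [Equiv.sigmaFiberEquiv, c.2]

lemma dvd_msize (d : ℕ) (g : ℕ → ℕ) (hz : ∀ n, ¬ d ∣ n → g n = 0) (r : MTy g →₀ ℕ) :
    d ∣ msize g r := by
  unfold msize
  refine Finset.dvd_sum fun t _ => ?_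
  apply Dvd.dvd.mul_left
  by_contra h
  have := hz _ h
  have := t.2.2
  omega

lemma cN_upper (d : ℕ) (g : ℕ → ℕ) (ρ : ℝ) (hg0 : g 0 = 0) (hρ1 : ρ < 1)
    (hsub : SubexpClass d (fun k => (g k : ℝ)) ρ) (U : ℝ)
    (hU : HasSum (fun r : MTy g →₀ ℕ => ρ ^ msize g r) U) :
    Tendsto (fun m => ((g (d*m) : ℝ) * ρ ^ (d*m)) / ((g (d*(m+1)) : ℝ) * ρ ^ (d*(m+1)))) atTop (𝓝 1) ∧
    ∀ δ > 0, ∀ᶠ m in atTop, (cN g (d*m) : ℝ) * ρ ^ (d*m) ≤ (U + δ) * (g (d*m) * ρ ^ (d*m)) := by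
  obtain ⟨hd, h0, -, hz, ⟨N, hN⟩, hs, -, hr, hc⟩ := hsub
  simp only at hz hN hs hr hc
  have hz' : ∀ n, ¬ d ∣ n → g n = 0 := fun n h => by exact_mod_cast hz n h
  have hinj : Function.Injective (fun l : ℕ => d * l) := fun a b h => Nat.eq_of_mul_eq_mul_left hd h
  set a : ℕ → ℝ := fun m => (g (d*m) : ℝ) * ρ ^ (d*m) with ha
  set u : ℕ → ℝ := fun m => (cN g (d*m) : ℝ) * ρ ^ (d*m) with hu
  set β : ℕ → ℝ := fun m => (Bd g (d*m) : ℝ) / (d*m : ℕ) * ρ ^ (d*m) with hβ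
  have ha0 : ∀ m, 0 ≤ a m := fun m => by positivity
  have hu0 : ∀ m, 0 ≤ u m := fun m => by positivity
  have hβ0 : ∀ m, 0 ≤ β m := fun m => by positivity
  have hNm : ∀ m, N ≤ m → 0 < a m := fun m hm => by
    have := hN (d*m) (by nlinarith) (Dvd.intro _ rfl)
    positivity
  have hsa : Summable a := hs.comp_injective hinj
  have htsa : ∑' m, a m = ∑' n, (g n : ℝ) * ρ ^ n := by
    refine hinj.tsum_eq (f := fun n => (g n : ℝ) * ρ ^ n) ?_
    intro n hn
    by_contra h
    have : ¬ d ∣ n := fun ⟨l, hl⟩ => h ⟨l, hl.symm⟩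
    simp [hz' n this] at hn
  have hcN := cN_hasSum g hg0 ρ U hU
  have hsu : Summable u := hcN.summable.comp_injective hinj
  have htsu : ∑' m, u m ≤ U := by
    rw [← hcN.tsum_eq]
    exact tsum_comp_le_tsum_of_inj hcN.summable (fun n => by positivity) hinj
  have hra : Tendsto (fun m => a m / a (m+1)) atTop (𝓝 1) := by
    have h := hr.mul_const ((ρ ^ d)⁻¹)
    rw [mul_inv_cancel₀ (by positivity)] at h
    refine h.congr fun m => ?_
    simp only [ha]
    rw [show d * (m+1) = d*m + d by ring, pow_add]
    have : ρ ^ (d*m) ≠ 0 := by positivity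
    have : ρ ^ d ≠ 0 := by positivity
    field_simp
  have hca : Tendsto (fun m => (∑ k ∈ range (m+1), a k * a (m-k)) / a m) atTop
      (𝓝 (2 * ∑' k, a k)) := by
    rw [htsa]
    refine hc.congr fun m => ?_
    rw [sum_mult d hd (fun i => (g i : ℝ) * g (d*m-i)) (fun n hn => by simp [hz' n hn])]
    have : ∑ k ∈ range (m+1), a k * a (m-k)
        = (∑ l ∈ range (m+1), (g (d*l) : ℝ) * g (d*m-d*l)) * ρ ^ (d*m) := by
      rw [Finset.sum_mul]
      refine Finset.sum_congr rfl fun l hl => ?_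
      have := Finset.mem_range.1 hl
      have e : ρ ^ (d*m) = ρ ^ (d*l) * ρ ^ (d*(m-l)) := by
        rw [← pow_add, ← mul_add]; congr 2; omega
      rw [e, ← Nat.mul_sub]
      simp only [ha]; ring
    rw [this]
    simp only [ha]
    rw [mul_div_mul_right _ _ (by positivity)]
  have hsqa : Tendsto (fun m => ((√ρ) ^ d) ^ m / a m) atTop (𝓝 0) := by
    have hsq0 : 0 < √ρ := Real.sqrt_pos.2 h0
    have hlt : (√ρ) ^ d < 1 := by
      apply pow_lt_one₀ hsq0.le _ (by omega)
      rw [Real.sqrt_lt' one_pos]; simpa using hρ1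
    refine (summable_of_ratio_test_tendsto_lt_one hlt ?_ ?_).tendsto_atTop_zero
    · filter_upwards [eventually_ge_atTop N] with m hm
      have := hNm m hm
      positivity
    · have h := hra.const_mul ((√ρ) ^ d)
      rw [mul_one] at h
      refine h.congr' ?_
      filter_upwards [eventually_ge_atTop N] with m hm
      have h1 := hNm m hm
      have h2 := hNm (m+1) (by omega)
      rw [Real.norm_of_nonneg (by positivity), Real.norm_of_nonneg (by positivity), pow_succ]
      field_simp
  have hβa : Tendsto (fun m => β m / a m) atTop (𝓝 1) := by
    have h := (hsqa.const_mul (∑' n, (g n : ℝ) * ρ ^ n)).const_add 1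
    rw [mul_zero, add_zero] at h
    refine tendsto_of_tendsto_of_tendsto_of_le_of_le' tendsto_const_nhds h ?_ ?_
    · filter_upwards [eventually_ge_atTop (N+1)] with m hm
      have hp := hNm m (by omega)
      rw [le_div_iff₀ hp, one_mul]
      have hdm : d * m ≠ 0 := Nat.mul_ne_zero (by omega) (by omega)
      have hdm0 : (0:ℝ) < (d*m : ℕ) := by exact_mod_cast Nat.pos_of_ne_zero hdm
      have := Bd_lower g (d*m) hdm
      have h3 : ((d*m : ℕ) : ℝ) * g (d*m) ≤ Bd g (d*m) := by exact_mod_cast this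
      simp only [ha, hβ]
      gcongr
      rw [le_div_iff₀ hdm0, mul_comm]
      exact h3
    · filter_upwards [eventually_ge_atTop (N+1)] with m hm
      have hp := hNm m (by omega)
      have hdm : d * m ≠ 0 := Nat.mul_ne_zero (by omega) (by omega)
      have := Bd_upper g ρ h0 hρ1 hs (d*m) hdm
      rw [div_le_iff₀ hp]
      refine this.trans (le_of_eq ?_)
      rw [← pow_mul]
      change a m + _ = _
      field_simp
  have hrec : ∀ m : ℕ, m * u m ≤ ∑ k ∈ range (m+1), k * β k * u (m-k) := by
    intro m
    have h1 := cN_rec g hg0 (d*m)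
    have h2 : ((d*m : ℕ) : ℝ) * cN g (d*m) ≤
        ∑ k ∈ range (d*m+1), (Bd g k : ℝ) * cN g (d*m-k) := by exact_mod_cast h1
    rw [sum_mult d hd (fun k => (Bd g k : ℝ) * cN g (d*m-k))
      (fun n hn => by simp [Bd_zero d g hz' n hn])] at h2
    have hd0 : (0:ℝ) < d := by exact_mod_cast hd
    have e : ∑ k ∈ range (m+1), k * β k * u (m-k)
        = (∑ l ∈ range (m+1), (Bd g (d*l) : ℝ) * cN g (d*m-d*l)) * (ρ ^ (d*m) / d) := by
      rw [Finset.sum_mul]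
      refine Finset.sum_congr rfl fun l hl => ?_
      have := Finset.mem_range.1 hl
      have e : ρ ^ (d*m) = ρ ^ (d*l) * ρ ^ (d*(m-l)) := by
        rw [← pow_add, ← mul_add]; congr 2; omega
      rw [e, ← Nat.mul_sub]
      simp only [hu, hβ]
      rcases Nat.eq_zero_or_pos l with rfl | hl0
      · simp [Bd]
      · have : (l:ℝ) ≠ 0 := by exact_mod_cast hl0.ne'
        push_cast
        field_simp
    rw [e]
    calc (m:ℝ) * u m = ((d*m : ℕ) : ℝ) * cN g (d*m) * (ρ ^ (d*m) / d) := by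
          simp only [hu]; push_cast; field_simp
      _ ≤ _ := by gcongr
  refine ⟨hra, fun δ hδ => ?_⟩
  filter_upwards [rt_main a β u ha0 hβ0 hu0 N hNm hsa hsu hra hca hβa hrec δ hδ] with m hm
  refine hm.trans ?_
  have := ha0 m
  change _ ≤ (U + δ) * a m
  gcongr

lemma dTV_le {S : Type*} (p q : S → ℝ) (s : ℝ) (hs : s ≤ 1) (hp : HasSum p s) (hq : HasSum q 1)
    (hp0 : ∀ x, 0 ≤ p x) (hq0 : ∀ x, 0 ≤ q x) :
    dTV p q ≤ ∑' x, max (q x - p x) 0 := by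
  have hsm : Summable (fun x => max (q x - p x) 0) := by
    refine Summable.of_nonneg_of_le (fun x => le_max_right _ _) (fun x => ?_) hq.summable
    have := hp0 x
    have := hq0 x
    exact max_le (by linarith) (by linarith)
  have key : ∀ E : Set S, (∑' x : E, q x) - ∑' x : E, p x ≤ ∑' x, max (q x - p x) 0 := by
    intro E
    have hqE : Summable (fun x : E => q x) := hq.summable.subtype E
    have hpE : Summable (fun x : E => p x) := hp.summable.subtype E
    rw [← hqE.tsum_sub hpE]
    refine le_trans ?_ (hsm.tsum_subtype_le _ E (fun x => le_max_right _ _))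
    exact Summable.tsum_le_tsum (fun x => le_max_left _ _) (hqE.sub hpE) (hsm.subtype E)
  refine ciSup_le fun E => ?_
  rw [abs_le]
  have h1 := key E
  have h2 := key Eᶜ
  have e1 := (hq.summable.subtype E).tsum_add_tsum_compl (hq.summable.subtype Eᶜ)
  have e2 := (hp.summable.subtype E).tsum_add_tsum_compl (hp.summable.subtype Eᶜ)
  rw [hq.tsum_eq] at e1
  rw [hp.tsum_eq] at e2
  constructor <;> linarith

lemma pointwise (d : ℕ) (g : ℕ → ℕ) (ρ : ℝ) (hg0 : g 0 = 0) (hρ1 : ρ < 1)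
    (hsub : SubexpClass d (fun k => (g k : ℝ)) ρ) (U : ℝ) (hU0 : 0 < U)
    (hU : HasSum (fun r : MTy g →₀ ℕ => ρ ^ msize g r) U) (r : MTy g →₀ ℕ) (ε : ℝ) (hε : 0 < ε) :
    ∀ᶠ m in atTop, U⁻¹ * ρ ^ msize g r - pRem g (d*m) r < ε := by
  obtain ⟨hra, hup⟩ := cN_upper d g ρ hg0 hρ1 hsub U hU
  obtain ⟨hd, h0, -, hz, ⟨N, hN⟩, hs, -, -, -⟩ := hsub
  simp only at hz hN hs
  have hz' : ∀ n, ¬ d ∣ n → g n = 0 := fun n h => by exact_mod_cast hz n h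
  obtain ⟨k, hk⟩ := dvd_msize d g hz' r
  set a : ℕ → ℝ := fun m => (g (d*m) : ℝ) * ρ ^ (d*m) with ha
  have hNm : ∀ m, N ≤ m → 0 < g (d*m) := fun m hm => by
    have := hN (d*m) (by nlinarith) (Dvd.intro _ rfl)
    exact_mod_cast this
  have hap : ∀ m, N ≤ m → 0 < a m := fun m hm => by
    have := hNm m hm
    positivity
  have hsh := rt_shift a N hap hra k
  obtain ⟨δ, hδ, hδ0⟩ : ∃ δ : ℝ, U⁻¹ * ρ ^ msize g r - ε < ρ ^ msize g r * 1 / (U + δ) ∧ 0 < δ := by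
    have ht : Tendsto (fun δ : ℝ => ρ ^ msize g r * 1 / (U + δ)) (𝓝[>] 0)
        (𝓝 (ρ ^ msize g r * 1 / (U + 0))) := by
      refine Tendsto.mono_left ?_ nhdsWithin_le_nhds
      exact tendsto_const_nhds.div (tendsto_const_nhds.add tendsto_id) (by simp [hU0.ne'])
    have h1 : U⁻¹ * ρ ^ msize g r - ε < ρ ^ msize g r * 1 / (U + 0) := by
      rw [add_zero, mul_one, div_eq_inv_mul]; linarith
    exact ((ht.eventually_const_lt h1).and self_mem_nhdsWithin).exists
  have hlim := ((hsh.const_mul (ρ ^ msize g r)).div_const (U + δ)).eventually_const_lt hδ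
  filter_upwards [hlim, hup δ hδ0, eventually_ge_atTop (N + 2 * k + 1)] with m h1 h2 hm
  have hgm := hNm m (by omega)
  have ham := hap m (by omega)
  have hc : (0:ℝ) < cN g (d*m) := by exact_mod_cast cN_pos g hg0 _ hgm
  have hlow := pRem_lower g (d*m) r (by rw [hk]; nlinarith)
  have e : (g (d*m - msize g r) : ℝ) / cN g (d*m)
      = ρ ^ msize g r * a (m-k) / (cN g (d*m) * ρ ^ (d*m)) := by
    have e2 : ρ ^ (d*m) = ρ ^ msize g r * ρ ^ (d*(m-k)) := by
      rw [hk, ← pow_add, ← mul_add]; congr 2; omega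
    rw [e2, hk, ← Nat.mul_sub]
    simp only [ha]
    field_simp
  have h3 : ρ ^ msize g r * (a (m-k) / a m) / (U + δ) ≤
      ρ ^ msize g r * a (m-k) / (cN g (d*m) * ρ ^ (d*m)) := by
    have : ρ ^ msize g r * (a (m-k) / a m) / (U + δ)
        = ρ ^ msize g r * a (m-k) / ((U + δ) * a m) := by field_simp
    rw [this]
    have : 0 ≤ a (m-k) := by positivity
    gcongr
  linarith

end RemAux

/-- If the generating series of the non-negative integers `(g_k)_{k ≥ 1}` (supported on
multiples of `d`) belongs to `𝒮_d` with radius of convergence `ρ ∈ (0,1)`, then the remainder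
`R_n` obtained from a uniformly random multiset of total size `n` by removing one element of
maximal size converges in total variation, along multiples of `d`, to the Boltzmann random
multiset `R`. -/
theorem remainder_total_variation_convergence
    (d : ℕ) (g : ℕ → ℕ) (ρ : ℝ) (hg0 : g 0 = 0) (hρ1 : ρ < 1)
    (hsub : SubexpClass d (fun k => (g k : ℝ)) ρ) :
    Filter.Tendsto
      (fun m => dTV (pRem g (d * m)) (pBoltz g ρ))
      Filter.atTop (nhds 0) := by
  have hsub' := hsub
  obtain ⟨hd, h0, -, -, -, hs, -, -, -⟩ := hsub'
  obtain ⟨U, hU0, hU, hP⟩ := boltz_hasSum g hg0 ρ h0 hρ1 hs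
  have hq : pBoltz g ρ = fun r => U⁻¹ * ρ ^ msize g r := by
    funext r
    rw [pBoltz, hP]
  have hq1 : HasSum (pBoltz g ρ) 1 := by
    rw [hq]
    have := hU.mul_left U⁻¹
    rwa [inv_mul_cancel₀ hU0.ne'] at this
  have hq0 : ∀ r, 0 ≤ pBoltz g ρ r := fun r => by rw [hq]; positivity
  have hlim : Filter.Tendsto (fun m => ∑' r, max (pBoltz g ρ r - pRem g (d * m) r) 0)
      Filter.atTop (nhds (∑' _ : MTy g →₀ ℕ, (0:ℝ))) := by
    refine tendsto_tsum_of_dominated_convergence hq1.summable (fun r => ?_)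
      (Filter.Eventually.of_forall fun m r => ?_)
    · rw [Metric.tendsto_nhds]
      intro ε hε
      filter_upwards [pointwise d g ρ hg0 hρ1 hsub U hU0 hU r ε hε] with m hm
      rw [Real.dist_eq, sub_zero, abs_of_nonneg (le_max_right _ _), hq]
      exact max_lt hm hε
    · rw [Real.norm_of_nonneg (le_max_right _ _)]
      have := pRem_nonneg g (d * m) r
      exact max_le (by linarith) (hq0 r)
  rw [tsum_zero] at hlim
  refine squeeze_zero (fun m => ?_) (fun m => ?_) hlim
  · exact Real.iSup_nonneg fun E => abs_nonneg _
  · obtain ⟨s, hs1, hsum⟩ := pRem_hasSum g hg0 (d * m)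
    exact dTV_le _ _ s hs1 hsum hq1 (pRem_nonneg g (d * m)) hq0
end
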